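/- arXiv:1602.06894 — 2 statements merged into one kernel-verified Lean document; each statement's English description precedes it below -/
import Mathlib

section
/- If pyr(P) is a pyramid with base the polytope P, then xc(pyr(P)) = xc(P) + 1. -/
open Set

noncomputable section

/-- A polytope: the convex hull of a finite set of points. -/
def IsPolytope {N : ℕ} (P : Set (Fin N → ℝ)) : Prop :=
  ∃ S : Finset (Fin N → ℝ), P = convexHull ℝ (S : Set (Fin N → ℝ))

/-- Dimension of a set: the dimension of its affine hull (with `-1` for the empty set). -/
def pdim {N : ℕ} (P : Set (Fin N → ℝ)) : ℤ :=
  haveI := Classical.dec P.Nonempty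
  if P.Nonempty then (Module.finrank ℝ (affineSpan ℝ P).direction : ℤ) else -1

/-- `F` is a face of `P`: the subset of `P` where some linear functional bounded above on `P`
attains its maximum value.  This includes `∅` and `P` itself. -/
def IsFaceOf {N : ℕ} (F P : Set (Fin N → ℝ)) : Prop :=
  ∃ (c : Fin N → ℝ) (b : ℝ),
    (∀ x ∈ P, ∑ i, c i * x i ≤ b) ∧ F = {x ∈ P | ∑ i, c i * x i = b}

/-- A facet: a face of dimension one less than the polytope. -/
def IsFacetOf {N : ℕ} (F P : Set (Fin N → ℝ)) : Prop :=
  IsFaceOf F P ∧ pdim F + 1 = pdim P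

/-- A ridge: a face of dimension two less than the polytope. -/
def IsRidgeOf {N : ℕ} (F P : Set (Fin N → ℝ)) : Prop :=
  IsFaceOf F P ∧ pdim F + 2 = pdim P

def IsVertexOf {N : ℕ} (v : Fin N → ℝ) (P : Set (Fin N → ℝ)) : Prop :=
  IsFaceOf {v} P

def vertexSet {N : ℕ} (P : Set (Fin N → ℝ)) : Set (Fin N → ℝ) :=
  {v | IsVertexOf v P}

def vertexCount {N : ℕ} (P : Set (Fin N → ℝ)) : ℕ := (vertexSet P).ncard

def facetCount {N : ℕ} (P : Set (Fin N → ℝ)) : ℕ := {F | IsFacetOf F P}.ncard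

/-- Extension complexity: the minimal number of facets of a polytope (in any dimension)
admitting an affine projection onto `P`. -/
def xc {N : ℕ} (P : Set (Fin N → ℝ)) : ℕ :=
  sInf {n | ∃ (e : ℕ) (Q : Set (Fin e → ℝ)) (π : (Fin e → ℝ) →ᵃ[ℝ] (Fin N → ℝ)),
    IsPolytope Q ∧ π '' Q = P ∧ facetCount Q = n}

/-- Combinatorial equivalence: an inclusion-preserving bijection between face lattices. -/
def CombEquiv {M N : ℕ} (P : Set (Fin M → ℝ)) (Q : Set (Fin N → ℝ)) : Prop :=
  ∃ φ : {F : Set (Fin M → ℝ) // IsFaceOf F P} ≃ {G : Set (Fin N → ℝ) // IsFaceOf G Q},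
    ∀ F₁ F₂ : {F : Set (Fin M → ℝ) // IsFaceOf F P},
      F₁.1 ⊆ F₂.1 ↔ (φ F₁).1 ⊆ (φ F₂).1

/-- A full-dimensional `n`-simplex in `ℝ^n` with the origin in its (relative) interior. -/
def simplexF (n : ℕ) : Set (Fin n → ℝ) :=
  convexHull ℝ ((Set.range fun i : Fin n => Pi.single i (1 : ℝ)) ∪ {fun _ => -1})

/-- The Cartesian product `Δ_n × Δ_m`, realized in `ℝ^{n+m}`. -/
def prodP (n m : ℕ) : Set (Fin (n + m) → ℝ) :=
  {z | ∃ a ∈ simplexF n, ∃ b ∈ simplexF m, z = Fin.append a b}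

/-- The direct sum `Δ_n ⊕ Δ_m`, realized in `ℝ^{n+m}`. -/
def sumP (n m : ℕ) : Set (Fin (n + m) → ℝ) :=
  convexHull ℝ (((fun a : Fin n → ℝ => Fin.append a (0 : Fin m → ℝ)) '' simplexF n) ∪
    ((fun b : Fin m → ℝ => Fin.append (0 : Fin n → ℝ) b) '' simplexF m))

/-- The join `A ⋆ B` of two polytopes, realized in `ℝ^{p+q+1}` with the two copies
placed in skew affine subspaces. -/
def joinP {p q : ℕ} (A : Set (Fin p → ℝ)) (B : Set (Fin q → ℝ)) :
    Set (Fin (p + q + 1) → ℝ) :=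
  convexHull ℝ
    (((fun a : Fin p → ℝ =>
        Fin.append (Fin.append a (0 : Fin q → ℝ)) (fun _ : Fin 1 => (0 : ℝ))) '' A) ∪
     ((fun b : Fin q → ℝ =>
        Fin.append (Fin.append (0 : Fin p → ℝ) b) (fun _ : Fin 1 => (1 : ℝ))) '' B))

/-- The canonical `k`-fold iterated pyramid over `X`, realized in `ℝ^{p+k}`. -/
def pyrK {p : ℕ} (k : ℕ) (X : Set (Fin p → ℝ)) : Set (Fin (p + k) → ℝ) :=
  convexHull ℝ (((fun x : Fin p → ℝ => Fin.append x (0 : Fin k → ℝ)) '' X) ∪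
    Set.range (fun j : Fin k => Fin.append (0 : Fin p → ℝ) (Pi.single j (1 : ℝ))))

/-- Transport a subset of `ℝ^a` to `ℝ^b` along a proof that `a = b`. -/
def castSet {a b : ℕ} (h : a = b) (X : Set (Fin a → ℝ)) : Set (Fin b → ℝ) :=
  (fun x : Fin a → ℝ => fun i : Fin b => x (Fin.cast h.symm i)) '' X

/-- Projective equivalence of two subsets of `ℝ^N`: `Q` is the image of `P` under a
projective transformation `x ↦ (A x + b) / (⟨c, x⟩ + δ)` whose associated
`(N+1) × (N+1)` matrix is invertible and whose denominator is positive on `P`. -/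
def ProjEquiv {N : ℕ} (P Q : Set (Fin N → ℝ)) : Prop :=
  ∃ (A : (Fin N → ℝ) →ₗ[ℝ] (Fin N → ℝ)) (b c : Fin N → ℝ) (δ : ℝ),
    Function.Bijective
      (fun z : (Fin N → ℝ) × ℝ => (A z.1 + z.2 • b, (∑ i, c i * z.1 i) + δ * z.2)) ∧
    (∀ x ∈ P, 0 < (∑ i, c i * x i) + δ) ∧
    Q = (fun x : Fin N → ℝ => ((∑ i, c i * x i) + δ)⁻¹ • (A x + b)) '' P

/-- `P` is a pyramid with base `B`: the convex hull of `B` and a point outside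
the affine hull of `B`. -/
def IsPyramidOver {N : ℕ} (P B : Set (Fin N → ℝ)) : Prop :=
  ∃ a : Fin N → ℝ, a ∉ affineSpan ℝ B ∧ P = convexHull ℝ (B ∪ {a})

/-- `P` is a `k`-fold iterated pyramid over `B`. -/
def IsKFoldPyramidOver {N : ℕ} : ℕ → Set (Fin N → ℝ) → Set (Fin N → ℝ) → Prop
  | 0, P, B => P = B
  | k + 1, P, B => ∃ P' : Set (Fin N → ℝ), IsPyramidOver P P' ∧ IsKFoldPyramidOver k P' B

/-- `P` is a pyramid: the convex hull of one of its facets together with one more vertex. -/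
def IsPyramidPolytope {N : ℕ} (P : Set (Fin N → ℝ)) : Prop :=
  ∃ (F : Set (Fin N → ℝ)) (v : Fin N → ℝ),
    IsFacetOf F P ∧ IsVertexOf v P ∧ P = convexHull ℝ (F ∪ {v})

/-- A facet is pyramidal if it contains all vertices of the polytope but one. -/
def IsPyramidalFacet {N : ℕ} (F P : Set (Fin N → ℝ)) : Prop :=
  IsFacetOf F P ∧ ∃ v, IsVertexOf v P ∧ v ∉ F ∧ ∀ w, IsVertexOf w P → w ≠ v → w ∈ F

/-- The projection `π_d : ℝ^{d+1} → ℝ^d` forgetting the last coordinate. -/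
def projFun (d : ℕ) : (Fin (d + 1) → ℝ) → (Fin d → ℝ) :=
  fun x i => x i.castSucc

/-- `c` is an outer normal vector exposing the face `F` of `Q`. -/
def IsOuterNormal {N : ℕ} (Q F : Set (Fin N → ℝ)) (c : Fin N → ℝ) : Prop :=
  ∃ b : ℝ, (∀ x ∈ Q, ∑ i, c i * x i ≤ b) ∧ F = {x ∈ Q | ∑ i, c i * x i = b}

/-- An upper facet: outer normal with positive last coordinate. -/
def IsUpperFacet {d : ℕ} (F Q : Set (Fin (d + 1) → ℝ)) : Prop :=
  IsFacetOf F Q ∧ ∃ c, IsOuterNormal Q F c ∧ 0 < c (Fin.last d)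

/-- A lower facet: outer normal with negative last coordinate. -/
def IsLowerFacet {d : ℕ} (F Q : Set (Fin (d + 1) → ℝ)) : Prop :=
  IsFacetOf F Q ∧ ∃ c, IsOuterNormal Q F c ∧ c (Fin.last d) < 0

/-- A vertical facet: every outer normal has vanishing last coordinate. -/
def IsVerticalFacet {d : ℕ} (F Q : Set (Fin (d + 1) → ℝ)) : Prop :=
  IsFacetOf F Q ∧ ∀ c, IsOuterNormal Q F c → c (Fin.last d) = 0

/-- An equatorial ridge: a ridge that is the intersection of an upper and a lower facet. -/
def IsEquatorialRidge {d : ℕ} (F Q : Set (Fin (d + 1) → ℝ)) : Prop :=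
  IsRidgeOf F Q ∧ ∃ F₁ F₂ : Set (Fin (d + 1) → ℝ),
    IsUpperFacet F₁ Q ∧ IsLowerFacet F₂ Q ∧ F = F₁ ∩ F₂

/-- A face `F` of `Q` is preserved under the projection forgetting the last coordinate. -/
def PreservedFace {d : ℕ} (Q F : Set (Fin (d + 1) → ℝ)) : Prop :=
  IsFaceOf (projFun d '' F) (projFun d '' Q) ∧ projFun d ⁻¹' (projFun d '' F) ∩ Q = F

/-- A face `F` of `Q` is strictly preserved: preserved and of the same dimension as its image. -/
def StrictlyPreservedFace {d : ℕ} (Q F : Set (Fin (d + 1) → ℝ)) : Prop :=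
  PreservedFace Q F ∧ pdim (projFun d '' F) = pdim F

/-- A hexagon: a 2-dimensional polytope with exactly 6 vertices. -/
def IsHexagon {N : ℕ} (P : Set (Fin N → ℝ)) : Prop :=
  IsPolytope P ∧ pdim P = 2 ∧ vertexCount P = 6

/-- Three lines are concurrent: they share a common point, or they are pairwise parallel. -/
def ConcurrentLines {N : ℕ} (L₁ L₂ L₃ : AffineSubspace ℝ (Fin N → ℝ)) : Prop :=
  (∃ x, x ∈ L₁ ∧ x ∈ L₂ ∧ x ∈ L₃) ∨
    (AffineSubspace.Parallel L₁ L₂ ∧ AffineSubspace.Parallel L₂ L₃ ∧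
      AffineSubspace.Parallel L₁ L₃)

/-- A cyclic labeling of the vertices of a hexagon: consecutive points are joined by edges. -/
def CyclicLabeling {N : ℕ} (P : Set (Fin N → ℝ)) (p : Fin 6 → (Fin N → ℝ)) : Prop :=
  Function.Injective p ∧ Set.range p = vertexSet P ∧
    ∀ i : Fin 6, IsFaceOf (segment ℝ (p i) (p (i + 1))) P

/-- A Desarguian hexagon. -/
def Desarguian {N : ℕ} (P : Set (Fin N → ℝ)) : Prop :=
  ∃ p : Fin 6 → (Fin N → ℝ), CyclicLabeling P p ∧
    ConcurrentLines (affineSpan ℝ {p 0, p 1}) (affineSpan ℝ {p 5, p 2})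
      (affineSpan ℝ {p 3, p 4})

/-- A polytope is simplicial if every facet is a simplex. -/
def IsSimplicial {N : ℕ} (P : Set (Fin N → ℝ)) : Prop :=
  ∀ F : Set (Fin N → ℝ), IsFacetOf F P →
    ∃ S : Finset (Fin N → ℝ),
      AffineIndependent ℝ (Subtype.val : {x // x ∈ S} → (Fin N → ℝ)) ∧
      F = convexHull ℝ (S : Set (Fin N → ℝ))

section VectorConfiguration

open Module Submodule

variable {ι V : Type*} [AddCommGroup V] [Module ℝ V]

/-- `A` indexes the vectors of the configuration `v` lying on a supporting linear hyperplane of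
the cone generated by `v`. -/
def IsConfigFace (v : ι → V) (A : Set ι) : Prop :=
  ∃ φ : Dual ℝ V, (∀ i, 0 ≤ φ (v i)) ∧ A = {i | φ (v i) = 0}

/-- A facet of a vector configuration: a face of rank one less than the configuration. -/
def IsConfigFacet (v : ι → V) (A : Set ι) : Prop :=
  IsConfigFace v A ∧ finrank ℝ (span ℝ (v '' A)) + 1 = finrank ℝ (span ℝ (range v))

/-- A vector indexed by a point outside a face is not in the span of the face. -/
theorem IsConfigFace.mem_of_mem_span {v : ι → V} {A : Set ι} (hA : IsConfigFace v A) {i : ι}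
    (hi : v i ∈ span ℝ (v '' A)) : i ∈ A := by
  obtain ⟨φ, -, rfl⟩ := hA
  have hle : span ℝ (v '' {i | φ (v i) = 0}) ≤ LinearMap.ker φ :=
    span_le.2 (by rintro _ ⟨k, hk, rfl⟩; exact hk)
  exact hle hi

theorem IsConfigFacet.ne_univ {v : ι → V} {A : Set ι} (hA : IsConfigFacet v A) :
    A ≠ univ := by
  rintro rfl
  have := hA.2
  rw [image_univ] at this
  omega

/-- A face of a face is a face. -/
theorem IsConfigFace.image_val [Finite ι] {v : ι → V} {E : Set ι} (hE : IsConfigFace v E)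
    {G : Set E} (hG : IsConfigFace (fun i : E => v i) G) :
    IsConfigFace v (Subtype.val '' G) := by
  obtain ⟨φ, hφ, rfl⟩ := hE
  obtain ⟨γ, hγ, rfl⟩ := hG
  obtain ⟨M, hM⟩ := (Set.finite_range fun i => (1 - γ (v i)) / φ (v i)).bddAbove
  have hpos : ∀ i, φ (v i) ≠ 0 → 0 < M * φ (v i) + γ (v i) := fun i hi => by
    have h := hM (mem_range_self i)
    rw [div_le_iff₀ (lt_of_le_of_ne (hφ i) (Ne.symm hi))] at h
    linarith
  refine ⟨M • φ + γ, fun i => ?_, ?_⟩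
  · by_cases hi : φ (v i) = 0
    · simpa [hi] using hγ ⟨i, hi⟩
    · simpa using (hpos i hi).le
  · ext i
    by_cases hi : φ (v i) = 0
    · refine ⟨?_, fun h => ⟨⟨i, hi⟩, ?_, rfl⟩⟩
      · rintro ⟨k, hk, rfl⟩
        have hk : γ (v k) = 0 := hk
        simp [hi, hk]
      · have h : γ (v i) = 0 := by simpa [hi] using h
        exact h
    · simpa [hi] using (hpos i hi).ne'

/-- Facets of the image of a configuration under an injective linear map are facets. -/
theorem IsConfigFacet.of_comp_injective {V' : Type*} [AddCommGroup V'] [Module ℝ V']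
    {v : ι → V} {g : V →ₗ[ℝ] V'} (hg : Function.Injective g) {A : Set ι}
    (hA : IsConfigFacet (g ∘ v) A) : IsConfigFacet v A := by
  obtain ⟨⟨φ, hφ, rfl⟩, h⟩ := hA
  refine ⟨⟨φ ∘ₗ g, hφ, rfl⟩, ?_⟩
  rwa [image_comp, range_comp, span_image, span_image,
    ← (equivMapOfInjective g hg _).finrank_eq, ← (equivMapOfInjective g hg _).finrank_eq] at h

variable [FiniteDimensional ℝ V]

/-- A face that misses `j` and has rank at least two less than the configuration is contained in a
strictly larger face that misses `j`. -/
theorem IsConfigFace.exists_ssubset_of_not_facet [Finite ι] {v : ι → V} {A : Set ι}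
    (hA : IsConfigFace v A) {j : ι} (hj : j ∉ A) (hAf : ¬ IsConfigFacet v A) :
    ∃ A', IsConfigFace v A' ∧ A ⊂ A' ∧ j ∉ A' := by
  set W := span ℝ (v '' A) ⊔ span ℝ {v j} with hW
  have hrank : finrank ℝ W = finrank ℝ (span ℝ (v '' A)) + 1 :=
    finrank_sup_span_singleton fun h => hj (hA.mem_of_mem_span h)
  have hi : ∃ i, v i ∉ W := by
    by_contra! h
    have hWeq : W = span ℝ (range v) := by
      refine le_antisymm (sup_le (span_mono (image_subset_range _ _)) (span_mono ?_))
        (span_le.2 (by rintro _ ⟨k, rfl⟩; exact h k))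
      rintro _ rfl
      exact mem_range_self j
    exact hAf ⟨hA, by rw [← hrank, hWeq]⟩
  obtain ⟨i, hi⟩ := hi
  have hψ : ∃ ψ : Dual ℝ V, ψ (v i) < 0 ∧ ∀ x ∈ W, ψ x = 0 := by
    obtain ⟨ψ, hψi, hψ⟩ := exists_dual_map_eq_bot_of_notMem hi inferInstance
    have hψ' : ∀ x ∈ W, ψ x = 0 := fun x hx => by
      have := mem_map_of_mem (f := ψ) hx
      rwa [hψ, mem_bot] at this
    rcases lt_or_gt_of_ne hψi with h | h
    · exact ⟨ψ, h, hψ'⟩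
    · exact ⟨-ψ, by simpa using h, fun x hx => by simp [hψ' x hx]⟩
  obtain ⟨ψ, hψi, hψ⟩ := hψ
  have hψA : ∀ k ∈ A, ψ (v k) = 0 := fun k hk =>
    hψ _ (mem_sup_left (subset_span (mem_image_of_mem v hk)))
  have hψj : ψ (v j) = 0 := hψ _ (mem_sup_right (mem_span_singleton_self _))
  obtain ⟨φ, hφ, rfl⟩ := hA
  obtain ⟨k, hk, hmin⟩ := Set.exists_min_image {k | ψ (v k) < 0}
    (fun k => φ (v k) / -ψ (v k)) (Set.toFinite _) ⟨i, hψi⟩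
  have hk : ψ (v k) < 0 := hk
  set t := φ (v k) / -ψ (v k) with ht
  have ht0 : 0 ≤ t := div_nonneg (hφ k) (by linarith)
  have htk : φ (v k) + t * ψ (v k) = 0 := by
    have : ψ (v k) ≠ 0 := hk.ne
    rw [ht]
    field_simp
    ring
  refine ⟨{m | (φ + t • ψ) (v m) = 0}, ⟨φ + t • ψ, fun m => ?_, rfl⟩, ?_, ?_⟩
  · simp only [LinearMap.add_apply, LinearMap.smul_apply, smul_eq_mul]
    rcases lt_or_ge (ψ (v m)) 0 with hm | hm
    · have := hmin m hm
      rw [le_div_iff₀ (by linarith)] at this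
      linarith
    · have := hφ m
      positivity
  · refine (ssubset_iff_of_subset fun m hm => ?_).2 ⟨k, ?_, fun hk' => hk.ne (hψA k hk')⟩
    · have hm' : φ (v m) = 0 := hm
      simp [hm', hψA m hm]
    · simpa using htk
  · simpa [hψj] using hj

/-- Every face that misses `j` is contained in a facet that misses `j`. -/
theorem IsConfigFace.exists_facet [Finite ι] {v : ι → V} {A : Set ι}
    (hA : IsConfigFace v A) {j : ι} (hj : j ∉ A) :
    ∃ H, IsConfigFacet v H ∧ A ⊆ H ∧ j ∉ H := by
  obtain ⟨H, ⟨hH, hAH, hjH⟩, hmax⟩ :=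
    (Set.toFinite {H | IsConfigFace v H ∧ A ⊆ H ∧ j ∉ H}).exists_maximal ⟨A, hA, Subset.rfl, hj⟩
  refine ⟨H, ?_, hAH, hjH⟩
  by_contra hHf
  obtain ⟨H', hH', hlt, hjH'⟩ := hH.exists_ssubset_of_not_facet hjH hHf
  exact hlt.2 (hmax ⟨hH', hAH.trans hlt.1, hjH'⟩ hlt.1)

/-- A proper face has fewer facets than the whole configuration. -/
theorem IsConfigFace.ncard_facets_add_one_le [Finite ι] {v : ι → V} {E : Set ι}
    (hE : IsConfigFace v E) (hne : E ≠ univ) :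
    {G | IsConfigFacet (fun i : E => v i) G}.ncard + 1 ≤ {H | IsConfigFacet v H}.ncard := by
  have hext : ∀ G : Set E, IsConfigFacet (fun i : E => v i) G →
      ∃ H, IsConfigFacet v H ∧ Subtype.val ⁻¹' H = G := by
    intro G hG
    obtain ⟨j, hj⟩ := (ne_univ_iff_exists_notMem G).1 hG.ne_univ
    obtain ⟨H, hH, hGH, hjH⟩ := (hE.image_val hG.1).exists_facet (j := j.1) (by simpa using hj)
    refine ⟨H, hH, Subset.antisymm (fun i hi => ?_) (image_subset_iff.1 hGH)⟩
    by_contra hiG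
    have hspan : span ℝ ((fun i : E => v i) '' G) ⊔ span ℝ {v i} =
        span ℝ (range fun i : E => v i) := by
      apply eq_of_le_of_finrank_eq
      · refine sup_le (span_mono (image_subset_range _ _)) (span_mono ?_)
        rintro _ rfl
        exact ⟨i, rfl⟩
      · rw [finrank_sup_span_singleton fun h => hiG (hG.1.mem_of_mem_span h), hG.2]
    have hle : span ℝ (range fun i : E => v i) ≤ span ℝ (v '' H) := by
      rw [← hspan]
      refine sup_le (span_mono ?_) (span_mono ?_)
      · rintro _ ⟨k, hk, rfl⟩
        exact ⟨k, hGH ⟨k, hk, rfl⟩, rfl⟩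
      · rintro _ rfl
        exact ⟨i, hi, rfl⟩
    exact hjH (hH.1.mem_of_mem_span (hle (subset_span ⟨j, rfl⟩)))
  choose! f hf hfG using hext
  obtain ⟨j, hj⟩ := (ne_univ_iff_exists_notMem E).1 hne
  obtain ⟨H₀, hH₀, hEH₀, -⟩ := hE.exists_facet hj
  have hnot : H₀ ∉ f '' {G | IsConfigFacet (fun i : E => v i) G} := by
    rintro ⟨G, hG, rfl⟩
    refine IsConfigFacet.ne_univ hG ?_
    rw [← hfG G hG]
    exact eq_univ_of_forall fun i => hEH₀ i.2
  have hinj : InjOn f {G | IsConfigFacet (fun i : E => v i) G} := fun G hG G' hG' h => by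
    rw [← hfG G hG, ← hfG G' hG', h]
  rw [← hinj.ncard_image, ← ncard_insert_of_notMem hnot (Set.toFinite _)]
  refine ncard_le_ncard (insert_subset hH₀ ?_) (Set.toFinite _)
  rintro _ ⟨G, hG, rfl⟩
  exact hf G hG

/-- Adding an apex to a configuration adds at most one facet. -/
theorem ncard_facets_option_le [Finite ι] {w : Option ι → V}
    (hw : w none ∉ span ℝ (range (w ∘ some))) :
    {H | IsConfigFacet w H}.ncard ≤ {G | IsConfigFacet (w ∘ some) G}.ncard + 1 := by
  have hrange : range w = insert (w none) (range (w ∘ some)) := by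
    rw [range_comp, ← image_insert_eq, ← image_univ]
    congr 1
    ext (_ | i) <;> simp
  have hrank : finrank ℝ (span ℝ (range w)) = finrank ℝ (span ℝ (range (w ∘ some))) + 1 := by
    rw [hrange, span_insert, sup_comm, finrank_sup_span_singleton hw]
  refine (ncard_le_ncard (t := insert (range some)
    ((fun G => insert none (some '' G)) '' {G | IsConfigFacet (w ∘ some) G})) ?_
    (Set.toFinite _)).trans ((ncard_insert_le _ _).trans
      (Nat.add_le_add_right (ncard_image_le (Set.toFinite _)) 1))
  intro H hH
  have hface : IsConfigFace (w ∘ some) (some ⁻¹' H) := by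
    obtain ⟨⟨φ, hφ, rfl⟩, -⟩ := hH
    exact ⟨φ, fun i => hφ _, rfl⟩
  have himg : w '' (some '' (some ⁻¹' H)) = (w ∘ some) '' (some ⁻¹' H) := by
    rw [image_comp]
  by_cases hnone : none ∈ H
  · right
    have hHeq : insert none (some '' (some ⁻¹' H)) = H := by
      ext (_ | i) <;> simp [hnone]
    refine ⟨some ⁻¹' H, ⟨hface, ?_⟩, hHeq⟩
    have h := hH.2
    rw [hrank, ← hHeq, image_insert_eq, himg, span_insert, sup_comm,
      finrank_sup_span_singleton fun h => hw (span_mono (image_subset_range _ _) h)] at h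
    omega
  · left
    have hHeq : some '' (some ⁻¹' H) = H := by
      ext (_ | i) <;> simp [hnone]
    have h := hH.2
    rw [hrank, ← hHeq, himg] at h
    have hspan := eq_of_le_of_finrank_eq
      (span_mono (R := ℝ) (image_subset_range (w ∘ some) (some ⁻¹' H))) (by omega)
    rw [← hHeq, ← image_univ]
    congr 1
    refine eq_univ_of_forall fun i => hface.mem_of_mem_span ?_
    rw [hspan]
    exact subset_span (mem_range_self i)

end VectorConfiguration

section Homogenization

open Module Submodule

variable {E : Type*} [AddCommGroup E] [Module ℝ E]

/-- Homogenization: the embedding of a vector space as the affine hyperplane at height one. -/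
def homogenize (x : E) : E × ℝ := (x, 1)

theorem homogenize_combo (x y : E) {a b : ℝ} (hab : a + b = 1) :
    homogenize (a • x + b • y) = a • homogenize x + b • homogenize y := by
  simp [homogenize, hab]

theorem finrank_span_homogenize [FiniteDimensional ℝ E] {A : Set E} (hA : A.Nonempty) :
    finrank ℝ (span ℝ (homogenize '' A)) = finrank ℝ (vectorSpan ℝ A) + 1 := by
  obtain ⟨p, hp⟩ := hA
  have hspan : span ℝ (homogenize '' A) =
      (vectorSpan ℝ A).map (LinearMap.inl ℝ E ℝ) ⊔ span ℝ {homogenize p} := by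
    apply le_antisymm
    · rw [span_le]
      rintro _ ⟨x, hx, rfl⟩
      have hxp : homogenize x = LinearMap.inl ℝ E ℝ (x - p) + homogenize p := by
        simp [homogenize]
      rw [hxp]
      exact add_mem (mem_sup_left (mem_map_of_mem (vsub_mem_vectorSpan ℝ hx hp)))
        (mem_sup_right (mem_span_singleton_self _))
    · refine sup_le ?_ (span_mono (singleton_subset_iff.2 (mem_image_of_mem _ hp)))
      rw [vectorSpan_eq_span_vsub_set_right ℝ hp, map_span, span_le]
      rintro _ ⟨_, ⟨x, hx, rfl⟩, rfl⟩
      have hxp : LinearMap.inl ℝ E ℝ (x -ᵥ p) = homogenize x - homogenize p := by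
        simp [homogenize]
      rw [hxp]
      exact sub_mem (subset_span (mem_image_of_mem _ hx)) (subset_span (mem_image_of_mem _ hp))
  rw [hspan, finrank_sup_span_singleton,
    ← (equivMapOfInjective _ LinearMap.inl_injective _).finrank_eq]
  rintro ⟨x, -, hx⟩
  simpa [homogenize] using congrArg Prod.snd hx

theorem nonneg_homogenize_of_mem_convexHull {T : Set E} {φ : Dual ℝ (E × ℝ)}
    (hφ : ∀ x ∈ T, 0 ≤ φ (homogenize x)) {x : E} (hx : x ∈ convexHull ℝ T) :
    0 ≤ φ (homogenize x) := by
  refine convexHull_min (t := {x | 0 ≤ φ (homogenize x)}) hφ ?_ hx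
  intro x hx y hy a b ha hb hab
  simp only [mem_ofPred_eq] at hx hy ⊢
  rw [homogenize_combo x y hab, map_add, map_smul, map_smul]
  exact add_nonneg (smul_nonneg ha hx) (smul_nonneg hb hy)

/-- A supporting hyperplane cuts the convex hull of `T` in the convex hull of its part of `T`. -/
theorem sep_convexHull_eq {T : Set E} {φ : Dual ℝ (E × ℝ)}
    (hφ : ∀ x ∈ T, 0 ≤ φ (homogenize x)) :
    {x ∈ convexHull ℝ T | φ (homogenize x) = 0} =
      convexHull ℝ {x ∈ T | φ (homogenize x) = 0} := by
  apply Subset.antisymm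
  · rintro x ⟨hx, hx0⟩
    refine (convexHull_min (t := {x | 0 ≤ φ (homogenize x) ∧ (φ (homogenize x) = 0 →
      x ∈ convexHull ℝ {x ∈ T | φ (homogenize x) = 0})})
      (fun x hx => ⟨hφ x hx, fun h0 => subset_convexHull ℝ _ ⟨hx, h0⟩⟩) ?_ hx).2 hx0
    rintro x ⟨hx, hxC⟩ y ⟨hy, hyC⟩ a b ha hb hab
    have hax := mul_nonneg ha hx
    have hby := mul_nonneg hb hy
    simp only [mem_ofPred_eq, homogenize_combo x y hab, map_add, map_smul, smul_eq_mul]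
    refine ⟨add_nonneg hax hby, fun h0 => ?_⟩
    have hax0 : a * φ (homogenize x) = 0 := by linarith
    have hby0 : b * φ (homogenize y) = 0 := by linarith
    rcases mul_eq_zero.1 hax0 with rfl | hx0
    · obtain rfl : b = 1 := by linarith
      simpa using hyC (by simpa using hby0)
    rcases mul_eq_zero.1 hby0 with rfl | hy0
    · obtain rfl : a = 1 := by linarith
      simpa using hxC hx0
    exact convex_convexHull ℝ _ (hxC hx0) (hyC hy0) ha hb hab
  · refine convexHull_min (fun x hx => ⟨subset_convexHull ℝ _ hx.1, hx.2⟩) ?_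
    refine (convex_convexHull ℝ T).inter ?_
    intro x hx y hy a b ha hb hab
    have hx : φ (homogenize x) = 0 := hx
    have hy : φ (homogenize y) = 0 := hy
    change φ (homogenize (a • x + b • y)) = 0
    rw [homogenize_combo x y hab, map_add, map_smul, map_smul, hx, hy]
    simp

/-- A point outside the affine span of `B` is separated from `B` by an affine functional. -/
theorem exists_dual_homogenize {B : Set E} {a : E} (ha : a ∉ affineSpan ℝ B) :
    ∃ φ : Dual ℝ (E × ℝ), (∀ x ∈ B, φ (homogenize x) = 0) ∧ 0 < φ (homogenize a) := by
  rcases B.eq_empty_or_nonempty with rfl | ⟨p, hp⟩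
  · exact ⟨LinearMap.snd ℝ E ℝ, by simp, by simp [homogenize]⟩
  have hap : a - p ∉ vectorSpan ℝ B := fun h => ha <| by
    have := AffineSubspace.vadd_mem_of_mem_direction
      (by rwa [direction_affineSpan]) (mem_affineSpan ℝ hp)
    simpa using this
  obtain ⟨ψ, hψa, hψ⟩ := exists_dual_map_eq_bot_of_notMem hap inferInstance
  have hψ0 : ∀ x ∈ B, ψ x - ψ p = 0 := fun x hx => by
    have := mem_map_of_mem (f := ψ) (vsub_mem_vectorSpan ℝ hx hp)
    rwa [hψ, mem_bot, vsub_eq_sub, map_sub] at this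
  set χ : Dual ℝ (E × ℝ) := ψ ∘ₗ LinearMap.fst ℝ E ℝ - ψ p • LinearMap.snd ℝ E ℝ with hχ
  have hχ_apply : ∀ x, χ (homogenize x) = ψ x - ψ p := fun x => by simp [hχ, homogenize]
  rw [map_sub] at hψa
  rcases lt_or_gt_of_ne hψa with h | h
  · refine ⟨-χ, fun x hx => ?_, ?_⟩
    · simp [hχ_apply, hψ0 x hx]
    · simpa [hχ_apply] using h
  · exact ⟨χ, fun x hx => by rw [hχ_apply, hψ0 x hx], by rwa [hχ_apply]⟩

end Homogenization

section Polytope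

open Module Submodule

variable {N : ℕ}

theorem isFaceOf_iff_exists_dual {F P : Set (Fin N → ℝ)} :
    IsFaceOf F P ↔ ∃ φ : Dual ℝ ((Fin N → ℝ) × ℝ),
      (∀ x ∈ P, 0 ≤ φ (homogenize x)) ∧ F = {x ∈ P | φ (homogenize x) = 0} := by
  constructor
  · rintro ⟨c, b, hb, rfl⟩
    refine ⟨b • LinearMap.snd ℝ _ ℝ - (∑ i, c i • LinearMap.proj i) ∘ₗ LinearMap.fst ℝ _ ℝ, ?_, ?_⟩
    · intro x hx
      simpa [homogenize] using hb x hx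
    · ext x
      simp [homogenize, sub_eq_zero, eq_comm (a := b)]
  · rintro ⟨φ, hφ, rfl⟩
    have key : ∀ x : Fin N → ℝ, φ (homogenize x) =
        φ (0, 1) - ∑ i, -φ (fun j => if i = j then 1 else 0, 0) * x i := by
      intro x
      have hx : homogenize x = (0, 1) + LinearMap.inl ℝ (Fin N → ℝ) ℝ x := by simp [homogenize]
      rw [hx, map_add, ← LinearMap.comp_apply, LinearMap.pi_apply_eq_sum_univ]
      simp [mul_comm]
    refine ⟨fun i => -φ (fun j => if i = j then 1 else 0, 0), φ (0, 1), fun x hx => ?_, ?_⟩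
    · have := hφ x hx
      rw [key] at this
      linarith
    · ext x
      simp only [mem_ofPred_eq, key, sub_eq_zero, eq_comm (a := φ (0, 1))]

theorem pdim_convexHull_add_one (A : Set (Fin N → ℝ)) :
    pdim (convexHull ℝ A) + 1 = finrank ℝ (span ℝ (homogenize '' A)) := by
  rcases A.eq_empty_or_nonempty with rfl | hA
  · rw [image_empty, span_empty, finrank_bot]
    simp [pdim]
  · rw [pdim, if_pos hA.convexHull, affineSpan_convexHull, direction_affineSpan,
      finrank_span_homogenize hA]
    push_cast
    rfl

variable {ι : Type*}

/-- The facets of a polytope are the convex hulls of the facets of the vector configuration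
obtained by homogenizing a finite generating family. -/
theorem facetCount_convexHull_range (s : ι → Fin N → ℝ) :
    facetCount (convexHull ℝ (range s)) = {A | IsConfigFacet (homogenize ∘ s) A}.ncard := by
  have hsep : ∀ φ : Dual ℝ ((Fin N → ℝ) × ℝ), {x ∈ range s | φ (homogenize x) = 0} =
      s '' {i | φ (homogenize (s i)) = 0} := fun φ => by
    ext x
    constructor
    · rintro ⟨⟨i, rfl⟩, hi⟩
      exact ⟨i, hi, rfl⟩
    · rintro ⟨i, hi, rfl⟩
      exact ⟨⟨i, rfl⟩, hi⟩
  have hdim : ∀ A : Set ι,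
      pdim (convexHull ℝ (s '' A)) + 1 = pdim (convexHull ℝ (range s)) ↔
      finrank ℝ (span ℝ ((homogenize ∘ s) '' A)) + 1 =
        finrank ℝ (span ℝ (range (homogenize ∘ s))) := fun A => by
    have h₁ := pdim_convexHull_add_one (s '' A)
    have h₂ := pdim_convexHull_add_one (range s)
    rw [image_comp, range_comp]
    omega
  have hinj : InjOn (fun A => convexHull ℝ (s '' A)) {A | IsConfigFacet (homogenize ∘ s) A} := by
    refine LeftInvOn.injOn (f₁' := fun F => s ⁻¹' F) ?_
    rintro _ ⟨⟨φ, hφ, rfl⟩, -⟩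
    have h := sep_convexHull_eq (T := range s) (φ := φ) (by rintro _ ⟨i, rfl⟩; exact hφ i)
    rw [hsep] at h
    ext i
    simp only [Function.comp_apply, ← h, mem_preimage, mem_ofPred_eq, and_iff_right_iff_imp]
    exact fun _ => subset_convexHull ℝ _ (mem_range_self i)
  rw [facetCount, ← hinj.ncard_image]
  congr 1
  ext F
  constructor
  · rintro ⟨hF, hd⟩
    obtain ⟨φ, hφ, rfl⟩ := isFaceOf_iff_exists_dual.1 hF
    have hφ' : ∀ x ∈ range s, 0 ≤ φ (homogenize x) :=
      fun x hx => hφ x (subset_convexHull ℝ _ hx)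
    rw [sep_convexHull_eq hφ', hsep] at hd ⊢
    exact ⟨_, ⟨⟨φ, fun i => hφ' _ (mem_range_self i), rfl⟩, (hdim _).1 hd⟩, rfl⟩
  · rintro ⟨A, ⟨⟨φ, hφ, rfl⟩, hd⟩, rfl⟩
    refine ⟨isFaceOf_iff_exists_dual.2 ⟨φ, fun x hx => ?_, ?_⟩, (hdim _).2 hd⟩
    · exact nonneg_homogenize_of_mem_convexHull (by rintro _ ⟨i, rfl⟩; exact hφ i) hx
    · rw [sep_convexHull_eq (by rintro _ ⟨i, rfl⟩; exact hφ i), hsep]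
      rfl

theorem IsPolytope.exists_range_eq {P : Set (Fin N → ℝ)} (hP : IsPolytope P) :
    ∃ (ι : Type) (_ : Finite ι) (s : ι → Fin N → ℝ), P = convexHull ℝ (range s) := by
  obtain ⟨S, rfl⟩ := hP
  exact ⟨S, inferInstance, Subtype.val, by simp⟩

theorem isPolytope_convexHull_range [Finite ι] (s : ι → Fin N → ℝ) :
    IsPolytope (convexHull ℝ (range s)) :=
  ⟨(Set.finite_range s).toFinset, by simp⟩

theorem xc_le {e : ℕ} {P : Set (Fin N → ℝ)} {Q : Set (Fin e → ℝ)}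
    {π : (Fin e → ℝ) →ᵃ[ℝ] (Fin N → ℝ)} (hQ : IsPolytope Q) (hπ : π '' Q = P) :
    xc P ≤ facetCount Q :=
  Nat.sInf_le ⟨e, Q, π, hQ, hπ, rfl⟩

theorem IsPolytope.exists_facetCount_eq_xc {P : Set (Fin N → ℝ)} (hP : IsPolytope P) :
    ∃ (e : ℕ) (Q : Set (Fin e → ℝ)) (π : (Fin e → ℝ) →ᵃ[ℝ] (Fin N → ℝ)),
      IsPolytope Q ∧ π '' Q = P ∧ facetCount Q = xc P :=
  Nat.sInf_mem (s := {n | ∃ (e : ℕ) (Q : Set (Fin e → ℝ)) (π : (Fin e → ℝ) →ᵃ[ℝ] (Fin N → ℝ)),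
    IsPolytope Q ∧ π '' Q = P ∧ facetCount Q = n}) ⟨_, N, P, AffineMap.id ℝ _, hP, by simp, rfl⟩

theorem IsPyramidOver.isPolytope {P B : Set (Fin N → ℝ)} (hP : IsPyramidOver P B)
    (hB : IsPolytope B) : IsPolytope P := by
  obtain ⟨a, -, rfl⟩ := hP
  obtain ⟨S, rfl⟩ := hB
  classical
  refine ⟨S ∪ {a}, ?_⟩
  rw [convexHull_convexHull_union_left]
  simp

/-- A proper face of a polytope has fewer facets than the polytope. -/
theorem facetCount_add_one_le_of_isFaceOf {F Q : Set (Fin N → ℝ)} (hQ : IsPolytope Q)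
    (hF : IsFaceOf F Q) (hne : F ≠ Q) : IsPolytope F ∧ facetCount F + 1 ≤ facetCount Q := by
  obtain ⟨ι, _, s, rfl⟩ := hQ.exists_range_eq
  obtain ⟨φ, hφ, rfl⟩ := isFaceOf_iff_exists_dual.1 hF
  have hφ' : ∀ x ∈ range s, 0 ≤ φ (homogenize x) :=
    fun x hx => hφ x (subset_convexHull ℝ _ hx)
  set E : Set ι := {i | φ (homogenize (s i)) = 0} with hE
  have hFeq : {x ∈ convexHull ℝ (range s) | φ (homogenize x) = 0} =
      convexHull ℝ (range fun i : E => s i) := by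
    rw [sep_convexHull_eq hφ']
    congr 1
    ext x
    constructor
    · rintro ⟨⟨i, rfl⟩, hi⟩
      exact ⟨⟨i, hi⟩, rfl⟩
    · rintro ⟨i, rfl⟩
      exact ⟨⟨i, rfl⟩, i.2⟩
  have hEface : IsConfigFace (homogenize ∘ s) E := ⟨φ, fun i => hφ' _ (mem_range_self i), rfl⟩
  have hEne : E ≠ univ := fun h => hne <| by
    refine hFeq.trans (congrArg _ (Subset.antisymm ?_ ?_))
    · rintro _ ⟨i, rfl⟩
      exact ⟨i, rfl⟩
    · rintro _ ⟨i, rfl⟩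
      exact ⟨⟨i, h ▸ mem_univ i⟩, rfl⟩
  rw [hFeq, facetCount_convexHull_range, facetCount_convexHull_range]
  exact ⟨isPolytope_convexHull_range _, hEface.ncard_facets_add_one_le hEne⟩

theorem IsPyramidOver.xc_add_one_le {P B : Set (Fin N → ℝ)} (hP : IsPyramidOver P B)
    (hB : IsPolytope B) : xc B + 1 ≤ xc P := by
  obtain ⟨e, Q, π, hQ, hπ, hcount⟩ := (hP.isPolytope hB).exists_facetCount_eq_xc
  obtain ⟨a, ha, rfl⟩ := hP
  obtain ⟨φ, hφB, hφa⟩ := exists_dual_homogenize ha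
  have hφ : ∀ x ∈ B ∪ {a}, 0 ≤ φ (homogenize x) := by
    rintro x (hx | rfl)
    · exact (hφB x hx).ge
    · exact hφa.le
  have hBface : {x ∈ convexHull ℝ (B ∪ {a}) | φ (homogenize x) = 0} = B := by
    have hsep : {x ∈ B ∪ {a} | φ (homogenize x) = 0} = B := by
      ext x
      constructor
      · rintro ⟨hx | rfl, hx0⟩
        · exact hx
        · exact absurd hx0 hφa.ne'
      · exact fun hx => ⟨Or.inl hx, hφB x hx⟩
    obtain ⟨S, rfl⟩ := hB
    rw [sep_convexHull_eq hφ, hsep, (convex_convexHull ℝ _).convexHull_eq]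
  set F := {y ∈ Q | φ (homogenize (π y)) = 0} with hF
  have hπF : π '' F = B := by
    rw [← hBface, ← hπ]
    ext x
    constructor
    · rintro ⟨y, hy, rfl⟩
      exact ⟨⟨y, hy.1, rfl⟩, hy.2⟩
    · rintro ⟨⟨y, hy, rfl⟩, hy0⟩
      exact ⟨y, ⟨hy, hy0⟩, rfl⟩
  have hFface : IsFaceOf F Q := by
    let g : (Fin e → ℝ) × ℝ →ₗ[ℝ] (Fin N → ℝ) × ℝ :=
      (π.linear.coprod (LinearMap.toSpanSingleton ℝ _ (π 0))).prod (LinearMap.snd ℝ _ ℝ)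
    have hg : ∀ y, (φ ∘ₗ g) (homogenize y) = φ (homogenize (π y)) := fun y => by
      have hy : π y = π.linear y + π 0 := congrFun π.decomp y
      simp [g, homogenize, hy]
    refine isFaceOf_iff_exists_dual.2 ⟨φ ∘ₗ g, fun y hy => ?_, by simp only [hg, hF]⟩
    rw [hg]
    exact nonneg_homogenize_of_mem_convexHull hφ (hπ ▸ mem_image_of_mem π hy)
  have hne : F ≠ Q := fun h => by
    rw [h, hπ] at hπF
    exact ha (subset_affineSpan ℝ _ (hπF ▸ subset_convexHull ℝ _ (Or.inr rfl)))
  obtain ⟨hFpoly, hle⟩ := facetCount_add_one_le_of_isFaceOf hQ hFface hne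
  have := xc_le hFpoly hπF
  omega

theorem IsPyramidOver.xc_le_add_one {P B : Set (Fin N → ℝ)} (hP : IsPyramidOver P B)
    (hB : IsPolytope B) : xc P ≤ xc B + 1 := by
  obtain ⟨e, Q, π, hQ, hπ, hcount⟩ := hB.exists_facetCount_eq_xc
  obtain ⟨a, -, rfl⟩ := hP
  obtain ⟨ι, _, s, rfl⟩ := hQ.exists_range_eq
  let L : ((Fin e → ℝ) × ℝ) ≃ₗ[ℝ] (Fin (e + 1) → ℝ) :=
    LinearEquiv.ofFinrankEq _ _ (by simp)
  let t : Option ι → Fin (e + 1) → ℝ := fun o => o.elim (L (0, 1)) fun i => L (s i, 0)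
  let ρ : (Fin (e + 1) → ℝ) →ᵃ[ℝ] (Fin N → ℝ) :=
    ((π.linear.coprod (LinearMap.toSpanSingleton ℝ _ (a - π 0))) ∘ₗ
      L.symm.toLinearMap).toAffineMap + AffineMap.const ℝ _ (π 0)
  have hρt : ρ '' range t = π '' range s ∪ {a} := by
    have hsome : ∀ i, ρ (t (some i)) = π (s i) := fun i => by
      have hy : π (s i) = π.linear (s i) + π 0 := congrFun π.decomp (s i)
      simp [ρ, t, hy]
    have hnone : ρ (t none) = a := by simp [ρ, t]
    rw [← range_comp, ← range_comp]
    ext x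
    simp only [mem_range, Function.comp_apply, Option.exists, hsome, hnone, mem_union,
      mem_singleton_iff, or_comm, eq_comm]
  have himage : ρ '' convexHull ℝ (range t) = convexHull ℝ (B ∪ {a}) := by
    rw [AffineMap.image_convexHull, hρt, ← hπ, AffineMap.image_convexHull,
      convexHull_convexHull_union_left]
  let g : (Fin e → ℝ) × ℝ →ₗ[ℝ] (Fin (e + 1) → ℝ) × ℝ :=
    (L.toLinearMap ∘ₗ LinearMap.inl ℝ _ ℝ).prodMap LinearMap.id
  have hg : Function.Injective g :=
    (L.injective.comp LinearMap.inl_injective).prodMap Function.injective_id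
  have hcomp : (homogenize ∘ t) ∘ some = g ∘ homogenize ∘ s := rfl
  have hapex : (homogenize ∘ t) none ∉ span ℝ (range ((homogenize ∘ t) ∘ some)) := fun h => by
    let χ : Dual ℝ ((Fin (e + 1) → ℝ) × ℝ) :=
      LinearMap.snd ℝ _ ℝ ∘ₗ L.symm.toLinearMap ∘ₗ LinearMap.fst ℝ _ ℝ
    have hle : span ℝ (range ((homogenize ∘ t) ∘ some)) ≤ LinearMap.ker χ := by
      rw [span_le]
      rintro _ ⟨i, rfl⟩
      simp [χ, t, homogenize]
    simpa [χ, t, homogenize] using hle h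
  calc xc (convexHull ℝ (B ∪ {a})) ≤ facetCount (convexHull ℝ (range t)) :=
        xc_le (isPolytope_convexHull_range t) himage
    _ ≤ {G | IsConfigFacet ((homogenize ∘ t) ∘ some) G}.ncard + 1 := by
        rw [facetCount_convexHull_range]
        exact ncard_facets_option_le hapex
    _ ≤ xc B + 1 := by
        rw [← hcount, facetCount_convexHull_range, hcomp]
        exact Nat.add_le_add_right
          (ncard_le_ncard (fun _ hG => hG.of_comp_injective hg) (Set.toFinite _)) 1

end Polytope

theorem xc_pyramid (N : ℕ) (P B : Set (Fin N → ℝ))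
    (hB : IsPolytope B) (hpyr : IsPyramidOver P B) :
    xc P = xc B + 1 :=
  le_antisymm (hpyr.xc_le_add_one hB) (hpyr.xc_add_one_le hB)

end
end

section
/- For a hexagon P (a 2-dimensional polytope with exactly 6 vertices), the following are equivalent: (i) xc(P) = 5; (ii) P = π(Q) for some polytope Q combinatorially equivalent to the triangular prism Δ_1 × Δ_2 and some affine map π; (iii) P is Desarguian, i.e., for some cyclic labeling p_0, p_1, …, p_5 of its vertices, the three lines through p_0 and p_1, through p_5 and p_2, and through p_3 and p_4 are concurrent (they meet in a common point, or are pairwise parallel). -/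
open Set

noncomputable section

/-- Faces are the zero loci of affine functionals that are nonnegative on the set. -/
theorem isFaceOf_iff {N : ℕ} {F P : Set (Fin N → ℝ)} :
    IsFaceOf F P ↔ ∃ f : (Fin N → ℝ) →ᵃ[ℝ] ℝ, (∀ x ∈ P, 0 ≤ f x) ∧ F = {x ∈ P | f x = 0} := by
  constructor
  · rintro ⟨c, b, h, rfl⟩
    refine ⟨AffineMap.const ℝ _ b - (Fintype.linearCombination ℝ c).toAffineMap, ?_, ?_⟩
    · intro x hx
      have := h x hx
      simp only [AffineMap.coe_sub, Pi.sub_apply, AffineMap.const_apply,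
        LinearMap.coe_toAffineMap, Fintype.linearCombination_apply, smul_eq_mul, sub_nonneg]
      simpa only [mul_comm] using this
    · ext x
      simp only [AffineMap.coe_sub, Pi.sub_apply, AffineMap.const_apply, mem_ofPred_eq,
        LinearMap.coe_toAffineMap, Fintype.linearCombination_apply, smul_eq_mul, sub_eq_zero]
      simp only [mul_comm, eq_comm]
  · rintro ⟨f, h, rfl⟩
    have key : ∀ x, ∑ i, (-f.linear (Pi.single i 1)) * x i = f 0 - f x := by
      intro x
      have h1 : f x = f.linear x + f 0 := by
        have := f.map_vadd 0 x
        simpa using this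
      have h2 : f.linear x = ∑ i, x i * f.linear (Pi.single i 1) := by
        conv_lhs => rw [pi_eq_sum_univ' x]
        simp [map_sum]
      rw [h1, h2]
      simp [mul_comm]
    refine ⟨fun i => -f.linear (Pi.single i 1), f 0, ?_, ?_⟩
    · intro x hx
      rw [key]
      linarith [h x hx]
    · ext x
      simp only [key, mem_ofPred_eq]
      constructor <;> rintro ⟨h1, h2⟩ <;> exact ⟨h1, by linarith⟩

theorem AffineMap.map_add_smul {E : Type*} [AddCommGroup E] [Module ℝ E] (f : E →ᵃ[ℝ] ℝ) (x y : E)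
    (t : ℝ) : f (x + t • y) = f x + t * f.linear y := by
  have := f.map_vadd x (t • y)
  simp only [vadd_eq_add, map_smul, smul_eq_mul] at this
  rw [add_comm x, this, add_comm]

theorem AffineMap.linear_sub_apply {E F : Type*} [AddCommGroup E] [Module ℝ E] [AddCommGroup F]
    [Module ℝ F] (f : E →ᵃ[ℝ] F) (x y : E) : f.linear (x - y) = f x - f y := by
  simpa using f.linearMap_vsub x y

theorem nonneg_of_mem_convexHull {E : Type*} [AddCommGroup E] [Module ℝ E] {S : Set E}
    {f : E →ᵃ[ℝ] ℝ} (h : ∀ s ∈ S, 0 ≤ f s) : ∀ x ∈ convexHull ℝ S, 0 ≤ f x :=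
  fun _ hx => convexHull_min (t := f ⁻¹' Ici 0) h ((convex_Ici 0).affine_preimage f) hx

theorem affineMap_convex_combo {E : Type*} [AddCommGroup E] [Module ℝ E] (f : E →ᵃ[ℝ] ℝ) (x y : E)
    {a b : ℝ} (hab : a + b = 1) : f (a • x + b • y) = a * f x + b * f y := by
  rw [Convex.combo_affine_apply hab]
  simp

/-- The zero locus of a functional nonnegative on `S` is spanned by the points of `S` in it. -/
theorem zeroLocus_convexHull {E : Type*} [AddCommGroup E] [Module ℝ E] {S : Set E}
    {f : E →ᵃ[ℝ] ℝ} (h : ∀ s ∈ S, 0 ≤ f s) :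
    {x ∈ convexHull ℝ S | f x = 0} = convexHull ℝ {s ∈ S | f s = 0} := by
  apply Subset.antisymm
  · rintro x ⟨hx, hfx⟩
    have key : x ∈ {x | 0 < f x ∨ (f x = 0 ∧ x ∈ convexHull ℝ {s ∈ S | f s = 0})} := by
      refine convexHull_min ?_ ?_ hx
      · intro s hs
        rcases (h s hs).lt_or_eq with h' | h'
        · exact Or.inl h'
        · exact Or.inr ⟨h'.symm, subset_convexHull _ _ ⟨hs, h'.symm⟩⟩
      · intro y hy z hz a b ha hb hab
        simp only [mem_ofPred_eq, affineMap_convex_combo f y z hab]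
        rcases ha.eq_or_lt with rfl | ha
        · have : b = 1 := by linarith
          subst this
          simpa using hz
        rcases hb.eq_or_lt with rfl | hb
        · have : a = 1 := by linarith
          subst this
          simpa using hy
        rcases hy with hy | ⟨hy, hy'⟩ <;> rcases hz with hz | ⟨hz, hz'⟩
        · exact Or.inl (by positivity)
        · left; rw [hz]; simp; positivity
        · left; rw [hy]; simp; positivity
        · right
          exact ⟨by rw [hy, hz]; simp, (convex_convexHull ℝ _) hy' hz' ha.le hb.le hab⟩
    rcases key with h' | h'
    · exact absurd hfx h'.ne'
    · exact h'.2
  · intro x hx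
    refine ⟨convexHull_mono (fun s hs => hs.1) hx, ?_⟩
    have : x ∈ f ⁻¹' {0} :=
      convexHull_min (fun s hs => hs.2) ((convex_singleton 0).affine_preimage f) hx
    exact this

/-- A polytope is the convex hull of its vertices. -/
theorem IsPolytope.exists_vertexSet {N : ℕ} {P : Set (Fin N → ℝ)} (hP : IsPolytope P) :
    ∃ S : Finset (Fin N → ℝ), P = convexHull ℝ (S : Set (Fin N → ℝ)) ∧ vertexSet P = S := by
  classical
  obtain ⟨S, hS, hmin⟩ : ∃ S : Finset (Fin N → ℝ), P = convexHull ℝ (S : Set (Fin N → ℝ)) ∧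
      ∀ T : Finset (Fin N → ℝ), P = convexHull ℝ (T : Set (Fin N → ℝ)) → S.card ≤ T.card := by
    have hex : ∃ n, ∃ S : Finset (Fin N → ℝ),
        P = convexHull ℝ (S : Set (Fin N → ℝ)) ∧ S.card = n := by
      obtain ⟨S, hS⟩ := hP
      exact ⟨_, S, hS, rfl⟩
    obtain ⟨S, hS, hc⟩ := Nat.find_spec hex
    exact ⟨S, hS, fun T hT => hc ▸ Nat.find_min' hex ⟨T, hT, rfl⟩⟩
  refine ⟨S, hS, ?_⟩
  ext v
  constructor
  · intro hv
    obtain ⟨f, hf, hvf⟩ := isFaceOf_iff.1 hv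
    rw [hS, zeroLocus_convexHull (fun s hs => hf s (hS ▸ subset_convexHull _ _ hs))] at hvf
    have hne : (convexHull ℝ {s ∈ (S : Set (Fin N → ℝ)) | f s = 0}).Nonempty := by
      rw [← hvf]; exact singleton_nonempty v
    obtain ⟨s, hs⟩ := convexHull_nonempty_iff.1 hne
    have : s ∈ ({v} : Set (Fin N → ℝ)) := hvf ▸ subset_convexHull _ _ hs
    rw [← mem_singleton_iff.1 this]
    exact hs.1
  · intro hv
    have hv' : v ∈ S := hv
    have hnot : v ∉ convexHull ℝ ((S.erase v : Finset (Fin N → ℝ)) : Set (Fin N → ℝ)) := by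
      intro hmem
      have : P = convexHull ℝ ((S.erase v : Finset (Fin N → ℝ)) : Set (Fin N → ℝ)) := by
        rw [hS]
        apply Subset.antisymm
        · refine convexHull_min ?_ (convex_convexHull _ _)
          intro s hs
          by_cases hsv : s = v
          · rw [hsv]; exact hmem
          · exact subset_convexHull _ _ (by simpa using ⟨hs, hsv⟩)
        · exact convexHull_mono (by simp)
      have h1 := hmin _ this
      have h2 := Finset.card_erase_lt_of_mem hv'
      omega
    obtain ⟨f, u, hfu, hfb⟩ := geometric_hahn_banach_point_closed (convex_convexHull ℝ _)
      ((Finset.finite_toSet _).isCompact_convexHull ℝ).isClosed hnot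
    set g : (Fin N → ℝ) →ᵃ[ℝ] ℝ :=
      (f : (Fin N → ℝ) →ₗ[ℝ] ℝ).toAffineMap - AffineMap.const ℝ _ (f v) with hg
    have hgs : ∀ s ∈ (S : Set (Fin N → ℝ)), s ≠ v → 0 < g s := by
      intro s hs hsv
      have := hfb s (subset_convexHull _ _ (by simpa using ⟨hs, hsv⟩))
      simp [hg]
      linarith
    have hgv : g v = 0 := by simp [hg]
    have hg0 : ∀ s ∈ (S : Set (Fin N → ℝ)), 0 ≤ g s := by
      intro s hs
      by_cases hsv : s = v
      · rw [hsv, hgv]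
      · exact (hgs s hs hsv).le
    refine isFaceOf_iff.2 ⟨g, ?_, ?_⟩
    · rw [hS]; exact nonneg_of_mem_convexHull hg0
    · rw [hS, zeroLocus_convexHull hg0]
      have : {s ∈ (S : Set (Fin N → ℝ)) | g s = 0} = {v} := by
        ext s
        simp only [mem_ofPred_eq, mem_singleton_iff]
        constructor
        · rintro ⟨h1, h2⟩
          by_contra hne
          exact (hgs s h1 hne).ne' h2
        · rintro rfl
          exact ⟨hv, hgv⟩
      rw [this, convexHull_singleton]

theorem pdim_of_nonempty {N : ℕ} {P : Set (Fin N → ℝ)} (h : P.Nonempty) :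
    pdim P = Module.finrank ℝ (vectorSpan ℝ P) := by
  rw [pdim, if_pos h, direction_affineSpan]

theorem pdim_empty {N : ℕ} : pdim (∅ : Set (Fin N → ℝ)) = -1 := by
  rw [pdim, if_neg Set.not_nonempty_empty]

theorem eq_zero_of_mem_affineSpan {E : Type*} [AddCommGroup E] [Module ℝ E] {S : Set E}
    {f : E →ᵃ[ℝ] ℝ} (h : ∀ s ∈ S, f s = 0) {x : E} (hx : x ∈ affineSpan ℝ S) : f x = 0 := by
  refine affineSpan_induction hx h ?_
  intro c u v w hu hv hw
  rw [AffineMap.map_vadd, map_smul, AffineMap.linearMap_vsub, hu, hv, hw]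
  simp

theorem vectorSpan_lt_vectorSpan {E : Type*} [AddCommGroup E] [Module ℝ E] {F G : Set E}
    (hne : F.Nonempty) (hFG : F ⊆ G) {f : E →ᵃ[ℝ] ℝ} (hF : ∀ x ∈ F, f x = 0) {y : E} (hy : y ∈ G)
    (hfy : f y ≠ 0) : vectorSpan ℝ F < vectorSpan ℝ G := by
  refine lt_of_le_of_ne (vectorSpan_mono ℝ hFG) ?_
  intro heq
  have : affineSpan ℝ F = affineSpan ℝ G := by
    refine AffineSubspace.ext_of_direction_eq (by rw [direction_affineSpan, direction_affineSpan,
      heq]) ?_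
    obtain ⟨x, hx⟩ := hne
    exact ⟨x, subset_affineSpan ℝ _ hx, subset_affineSpan ℝ _ (hFG hx)⟩
  exact hfy (eq_zero_of_mem_affineSpan hF (this ▸ subset_affineSpan ℝ _ hy))

theorem IsFaceOf.pdim_lt {N : ℕ} {F Q G : Set (Fin N → ℝ)} (hF : IsFaceOf F Q) (hFG : F ⊆ G)
    (hGQ : G ⊆ Q) (h : ¬ G ⊆ F) : pdim F < pdim G := by
  obtain ⟨f, -, rfl⟩ := isFaceOf_iff.1 hF
  obtain ⟨y, hyG, hyF⟩ := not_subset.1 h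
  rw [pdim_of_nonempty ⟨y, hyG⟩]
  rcases eq_empty_or_nonempty {x ∈ Q | f x = 0} with he | hne
  · rw [he, pdim_empty]
    exact lt_of_lt_of_le (by norm_num) (Int.natCast_nonneg _)
  · rw [pdim_of_nonempty hne]
    exact_mod_cast Submodule.finrank_lt_finrank_of_lt (vectorSpan_lt_vectorSpan hne hFG
      (fun x hx => hx.2) hyG (fun h0 => hyF ⟨hGQ hyG, h0⟩))

theorem IsFaceOf.subset {N : ℕ} {F Q : Set (Fin N → ℝ)} (hF : IsFaceOf F Q) : F ⊆ Q := by
  obtain ⟨c, b, -, rfl⟩ := hF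
  exact sep_subset _ _

theorem IsFacetOf.eq_of_subset {N : ℕ} {F G Q : Set (Fin N → ℝ)} (hF : IsFacetOf F Q)
    (hG : IsFaceOf G Q) (hFG : F ⊆ G) (hGQ : G ≠ Q) : F = G := by
  by_contra hne
  have h1 := hF.1.pdim_lt hFG hG.subset (fun h => hne (hFG.antisymm h))
  have h2 := hG.pdim_lt hG.subset Subset.rfl (fun h => hGQ (hG.subset.antisymm h))
  have := hF.2
  omega

theorem IsFaceOf.eq_convexHull {N : ℕ} {F : Set (Fin N → ℝ)} {S : Set (Fin N → ℝ)}
    (hF : IsFaceOf F (convexHull ℝ S)) : F = convexHull ℝ (F ∩ S) := by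
  obtain ⟨f, hf, rfl⟩ := isFaceOf_iff.1 hF
  rw [zeroLocus_convexHull (fun s hs => hf s (subset_convexHull _ _ hs))]
  apply Subset.antisymm
  · exact convexHull_mono (fun s hs => ⟨subset_convexHull _ _ hs, hs.1⟩)
  · exact convexHull_min (inter_subset_left) (convex_convexHull _ _)

theorem IsPolytope.finite_facets {N : ℕ} {Q : Set (Fin N → ℝ)} (hQ : IsPolytope Q) :
    {F | IsFacetOf F Q}.Finite := by
  obtain ⟨S, rfl⟩ := hQ
  refine (((S.finite_toSet).finite_subsets).image (convexHull ℝ)).subset ?_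
  intro F hF
  exact ⟨F ∩ S, inter_subset_right, hF.1.eq_convexHull.symm⟩

/-- A point of the affine hull outside a polytope violates a facet inequality. -/
theorem exists_facet_neg {N : ℕ} (S : Finset (Fin N → ℝ)) {x : Fin N → ℝ}
    (hxA : x ∈ affineSpan ℝ (S : Set (Fin N → ℝ)))
    (hx : x ∉ convexHull ℝ (S : Set (Fin N → ℝ))) :
    ∃ f : (Fin N → ℝ) →ᵃ[ℝ] ℝ, (∀ s ∈ S, 0 ≤ f s) ∧ f x < 0 ∧
      IsFacetOf {y ∈ convexHull ℝ (S : Set (Fin N → ℝ)) | f y = 0}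
        (convexHull ℝ (S : Set (Fin N → ℝ))) := by
  classical
  have hspan : affineSpan ℝ (convexHull ℝ (S : Set (Fin N → ℝ))) = affineSpan ℝ S :=
    affineSpan_convexHull _
  have main : ∀ n : ℕ, ∀ f : (Fin N → ℝ) →ᵃ[ℝ] ℝ, (∀ s ∈ S, 0 ≤ f s) → f x < 0 →
      (S.filter (fun s => f s ≠ 0)).card ≤ n →
      ∃ f : (Fin N → ℝ) →ᵃ[ℝ] ℝ, (∀ s ∈ S, 0 ≤ f s) ∧ f x < 0 ∧
      IsFacetOf {y ∈ convexHull ℝ (S : Set (Fin N → ℝ)) | f y = 0}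
        (convexHull ℝ (S : Set (Fin N → ℝ))) := by
    intro n
    induction n with
    | zero =>
      intro f hf hfx hcard
      exfalso
      have h0 : ∀ s ∈ (S : Set (Fin N → ℝ)), f s = 0 := by
        intro s hs
        by_contra hne
        have : s ∈ S.filter (fun s => f s ≠ 0) := by simpa using ⟨hs, hne⟩
        rw [Finset.card_eq_zero.1 (Nat.le_zero.1 hcard)] at this
        simp at this
      exact hfx.ne (eq_zero_of_mem_affineSpan h0 hxA)
    | succ n ih =>
      intro f hf hfx hcard
      by_cases hfac : IsFacetOf {y ∈ convexHull ℝ (S : Set (Fin N → ℝ)) | f y = 0}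
        (convexHull ℝ (S : Set (Fin N → ℝ)))
      · exact ⟨f, hf, hfx, hfac⟩
      have hfQ := nonneg_of_mem_convexHull (S := (S : Set (Fin N → ℝ))) hf
      set F := {y ∈ convexHull ℝ (S : Set (Fin N → ℝ)) | f y = 0} with hFdef
      have hF : IsFaceOf F (convexHull ℝ (S : Set (Fin N → ℝ))) := isFaceOf_iff.2 ⟨f, hfQ, rfl⟩
      have hFne : ¬ convexHull ℝ (S : Set (Fin N → ℝ)) ⊆ F := by
        intro hsub
        exact hfx.ne (eq_zero_of_mem_affineSpan
          (fun y hy => (hsub (subset_convexHull _ _ hy)).2) hxA)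
      have hlt := hF.pdim_lt hF.subset Subset.rfl hFne
      have hlt2 : pdim F + 1 < pdim (convexHull ℝ (S : Set (Fin N → ℝ))) :=
        lt_of_le_of_ne hlt (fun h => hfac ⟨hF, h⟩)
      obtain ⟨s0, hs0, hs0x⟩ : ∃ s ∈ S, s ∉ affineSpan ℝ (insert x F) := by
        by_contra hcon
        push Not at hcon
        have hle : affineSpan ℝ (convexHull ℝ (S : Set (Fin N → ℝ)))
            ≤ affineSpan ℝ (insert x F) := by
          rw [hspan]; exact affineSpan_le.2 hcon
        have hle' := AffineSubspace.direction_le hle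
        rw [direction_affineSpan, direction_affineSpan] at hle'
        have hfr := Submodule.finrank_mono hle'
        have hSne : (S : Set (Fin N → ℝ)).Nonempty :=
          (affineSpan_nonempty ℝ).1 ⟨x, hxA⟩
        rw [pdim_of_nonempty hSne.convexHull] at hlt2
        rcases eq_empty_or_nonempty F with he | hne
        · rw [he, pdim_empty] at hlt2
          rw [he, insert_empty_eq, vectorSpan_singleton, finrank_bot] at hfr
          omega
        · rw [pdim_of_nonempty hne] at hlt2
          have := finrank_vectorSpan_insert_le_set ℝ F x
          omega
      obtain ⟨φ, hφ, hφker⟩ : ∃ φ : (Fin N → ℝ) →ₗ[ℝ] ℝ, φ (s0 - x) < 0 ∧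
          vectorSpan ℝ (insert x F) ≤ LinearMap.ker φ := by
        have hnot : s0 - x ∉ vectorSpan ℝ (insert x F) := by
          intro hmem
          apply hs0x
          have := AffineSubspace.vadd_mem_of_mem_direction
            (s := affineSpan ℝ (insert x F)) (v := s0 - x) (p := x)
            (by rwa [direction_affineSpan]) (subset_affineSpan ℝ _ (mem_insert _ _))
          simpa using this
        obtain ⟨φ, h1, h2⟩ := Submodule.exists_le_ker_of_notMem hnot
        rcases lt_or_gt_of_ne h1 with h | h
        · exact ⟨φ, h, h2⟩
        · exact ⟨-φ, by simpa using h, fun v hv => by simpa using h2 hv⟩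
      set g : (Fin N → ℝ) →ᵃ[ℝ] ℝ := φ.toAffineMap - AffineMap.const ℝ _ (φ x) with hg
      have hgx : g x = 0 := by simp [hg]
      have hgF : ∀ y ∈ F, g y = 0 := by
        intro y hy
        have : y - x ∈ vectorSpan ℝ (insert x F) :=
          vsub_mem_vectorSpan ℝ (mem_insert_of_mem _ hy) (mem_insert _ _)
        have := hφker this
        simpa [hg] using this
      have hgs0 : g s0 < 0 := by simpa [hg] using hφ
      obtain ⟨s1, hs1, hmin⟩ := Finset.exists_min_image (S.filter (fun s => g s < 0))
        (fun s => f s / (-g s)) ⟨s0, by simpa using ⟨hs0, hgs0⟩⟩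
      rw [Finset.mem_filter] at hs1
      set t := f s1 / (-g s1) with ht
      have ht0 : 0 ≤ t := div_nonneg (hf _ hs1.1) (by linarith [hs1.2])
      have hf's1 : (f + t • g) s1 = 0 := by
        have : g s1 ≠ 0 := hs1.2.ne
        simp [ht]
        field_simp
        ring
      have hf'F : ∀ y ∈ F, (f + t • g) y = 0 := by
        intro y hy
        simp [hgF y hy, hy.2]
      refine ih (f + t • g) ?_ (by simpa [hgx] using hfx) ?_
      · intro s hs
        by_cases hgs : g s < 0
        · have := hmin s (by simpa using ⟨hs, hgs⟩)
          have h2 := (le_div_iff₀ (by linarith : 0 < -g s)).1 this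
          simp
          linarith
        · have := hf s hs
          simp
          push Not at hgs
          positivity
      · have hlt : (S.filter (fun s => (f + t • g) s ≠ 0)).card
            < (S.filter (fun s => f s ≠ 0)).card := by
          apply Finset.card_lt_card
          rw [Finset.ssubset_iff_of_subset]
          · refine ⟨s1, ?_, by simpa using fun _ => hf's1⟩
            simp only [Finset.mem_filter]
            refine ⟨hs1.1, fun h0 => ?_⟩
            have := hgF s1 ⟨subset_convexHull _ _ hs1.1, h0⟩
            linarith [hs1.2]
          · intro s hs
            simp only [Finset.mem_filter] at hs ⊢
            exact ⟨hs.1, fun h0 => hs.2 (hf'F s ⟨subset_convexHull _ _ hs.1, h0⟩)⟩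
        omega
  obtain ⟨f, u, hfu, hfb⟩ := geometric_hahn_banach_point_closed (convex_convexHull ℝ _)
    ((Finset.finite_toSet S).isCompact_convexHull ℝ).isClosed hx
  refine main _ ((f : (Fin N → ℝ) →ₗ[ℝ] ℝ).toAffineMap - AffineMap.const ℝ _ u) ?_ ?_ le_rfl
  · intro s hs
    have := hfb s (subset_convexHull _ _ hs)
    simp
    linarith
  · simp
    linarith

/-- Any two functionals exposing the same facet are negative at the same points of the
affine hull. -/
theorem IsFacetOf.neg_of_neg {N : ℕ} {Q : Set (Fin N → ℝ)} {f g : (Fin N → ℝ) →ᵃ[ℝ] ℝ}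
    (hf : ∀ y ∈ Q, 0 ≤ f y) (hg : ∀ y ∈ Q, 0 ≤ g y)
    (hfg : {y ∈ Q | f y = 0} = {y ∈ Q | g y = 0}) (hF : IsFacetOf {y ∈ Q | f y = 0} Q)
    (hd : 1 ≤ pdim Q) {x : Fin N → ℝ} (hx : x ∈ affineSpan ℝ Q) (hfx : f x < 0) : g x < 0 := by
  have hne : {y ∈ Q | f y = 0}.Nonempty := by
    rw [nonempty_iff_ne_empty]
    intro he
    have := hF.2
    rw [he, pdim_empty] at this
    omega
  have hQne : Q.Nonempty := hne.mono (sep_subset _ _)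
  obtain ⟨q, hqQ, hq⟩ : ∃ q ∈ Q, f q ≠ 0 := by
    by_contra hcon
    push Not at hcon
    have : {y ∈ Q | f y = 0} = Q := Subset.antisymm (sep_subset _ _) (fun y hy => ⟨hy, hcon y hy⟩)
    have h2 := hF.2
    rw [this] at h2
    omega
  have hfq : 0 < f q := lt_of_le_of_ne (hf q hqQ) hq.symm
  have hgq : 0 < g q := by
    refine lt_of_le_of_ne (hg q hqQ) fun h0 => hq ?_
    have : q ∈ {y ∈ Q | g y = 0} := ⟨hqQ, h0.symm⟩
    rw [← hfg] at this
    exact this.2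
  have hspan : affineSpan ℝ (insert q {y ∈ Q | f y = 0}) = affineSpan ℝ Q := by
    have hsub : insert q {y ∈ Q | f y = 0} ⊆ Q := insert_subset hqQ (sep_subset _ _)
    refine AffineSubspace.ext_of_direction_eq ?_
      ⟨q, subset_affineSpan ℝ _ (mem_insert _ _), subset_affineSpan ℝ _ hqQ⟩
    rw [direction_affineSpan, direction_affineSpan]
    refine Submodule.eq_of_le_of_finrank_le (vectorSpan_mono ℝ hsub) ?_
    have h1 := Submodule.finrank_lt_finrank_of_lt (vectorSpan_lt_vectorSpan hne
      (subset_insert q _) (fun x hx => hx.2) (mem_insert _ _) hq)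
    have h2 := hF.2
    rw [pdim_of_nonempty hne, pdim_of_nonempty hQne] at h2
    omega
  have h0 : (f q • g - g q • f) x = 0 := by
    refine eq_zero_of_mem_affineSpan (S := insert q {y ∈ Q | f y = 0}) ?_ (hspan ▸ hx)
    rintro y (rfl | hy)
    · simp [mul_comm]
    · have : y ∈ {y ∈ Q | g y = 0} := hfg ▸ hy
      simp [hy.2, this.2]
  simp at h0
  nlinarith

/-- A polytope with at most five facets is cut out of its affine hull by five inequalities, one of
which is trivial if there are fewer than five facets. -/
theorem exists_five_inequalities {N : ℕ} {Q : Set (Fin N → ℝ)} (hQ : IsPolytope Q)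
    (hd : 1 ≤ pdim Q) (h5 : facetCount Q ≤ 5) :
    ∃ l : Fin 5 → ((Fin N → ℝ) →ᵃ[ℝ] ℝ), (∀ y ∈ Q, ∀ i, 0 ≤ l i y) ∧
      (∀ y ∈ affineSpan ℝ Q, (∀ i, 0 ≤ l i y) → y ∈ Q) ∧
      (facetCount Q < 5 → ∃ i, ∀ y, l i y = 1) := by
  classical
  have hfin := hQ.finite_facets
  choose! g hg0 hgF using fun (F : Set (Fin N → ℝ)) (hF : F ∈ {F | IsFacetOf F Q}) =>
    isFaceOf_iff.1 hF.1
  obtain ⟨T, hT⟩ := hfin.exists_finset_coe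
  have hcard : T.card = facetCount Q := by
    rw [facetCount, ← hT, ncard_coe_finset]
  have hmem : ∀ F, F ∈ T ↔ IsFacetOf F Q := fun F => by
    rw [← Finset.mem_coe, hT]; rfl
  refine ⟨fun i => if h : (i : ℕ) < T.card then g (T.equivFin.symm ⟨i, h⟩)
    else AffineMap.const ℝ _ 1, ?_, ?_, ?_⟩
  · intro y hy i
    dsimp only
    split_ifs with h
    · exact hg0 _ ((hmem _).1 (T.equivFin.symm ⟨i, h⟩).2) y hy
    · simp
  · intro y hy h
    by_contra hyQ
    obtain ⟨S, rfl⟩ := hQ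
    rw [affineSpan_convexHull] at hy
    obtain ⟨f, hf, hfy, hF⟩ := exists_facet_neg S hy hyQ
    set F := {y ∈ convexHull ℝ (S : Set (Fin N → ℝ)) | f y = 0} with hFdef
    have hFT := (hmem F).2 hF
    have hlt := (T.equivFin ⟨F, hFT⟩).2
    have := h ⟨T.equivFin ⟨F, hFT⟩, by omega⟩
    simp only [hlt, dif_pos, Fin.eta, Equiv.symm_apply_apply] at this
    have hneg := IsFacetOf.neg_of_neg (nonneg_of_mem_convexHull hf) (hg0 F hF)
      (hgF F hF) hF hd (by rwa [affineSpan_convexHull]) hfy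
    linarith
  · intro hlt
    refine ⟨⟨4, by norm_num⟩, fun y => ?_⟩
    have : ¬ 4 < T.card := by omega
    simp [this]

/-- Vertices on each facet of a triangular prism, along a Hamiltonian cycle of its graph: first the
two triangles, then the three quadrilaterals. -/
def prismColumn : Fin 5 → Fin 6 → Bool :=
  ![![false, true, true, true, false, false], ![true, false, false, false, true, true],
    ![false, false, true, true, true, true], ![true, true, false, true, true, false],
    ![true, true, true, false, false, true]]

/-- The bit mask of a set of indices. -/
def colCode (c : Fin 6 → Bool) : ℕ := ∑ j : Fin 6, if c j then 2 ^ (j : ℕ) else 0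

/-- A cell `(m, v)` is covered by the column with code `c` if `c` agrees with `v` on `m`. -/
def coversCell (c : ℕ) (p : ℕ × ℕ) : Bool := Nat.beq (Nat.land c p.1) p.2

/-- The cell asking for a column containing `j` and `j + 1` but not `k`. -/
def cellCode (j k : Fin 6) : ℕ × ℕ :=
  (2 ^ (j : ℕ) + 2 ^ ((j + 1 : Fin 6) : ℕ) + 2 ^ (k : ℕ), 2 ^ (j : ℕ) + 2 ^ ((j + 1 : Fin 6) : ℕ))

def cellCodes : List (ℕ × ℕ) :=
  [(7, 3), (11, 3), (19, 3), (35, 3), (7, 6), (14, 6), (22, 6), (38, 6),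
    (13, 12), (14, 12), (28, 12), (44, 12), (25, 24), (26, 24), (28, 24), (56, 24),
    (49, 48), (50, 48), (52, 48), (56, 48), (35, 33), (37, 33), (41, 33), (49, 33)]

def isPrismCover (l : List ℕ) : Bool :=
  decide (∃ r : Fin 6, ∀ m : Fin 5, colCode (fun j => prismColumn m (j - r)) ∈ l)

/-- Two cells can be covered by one column. -/
def compatibleCells (p q : ℕ × ℕ) : Bool := Nat.beq (Nat.land p.2 q.1) (Nat.land q.2 p.1)

theorem compatibleCells_of_coversCell {c : ℕ} {p q : ℕ × ℕ} (hp : coversCell c p = true)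
    (hq : coversCell c q = true) : compatibleCells p q = true := by
  have hp' : c &&& p.1 = p.2 := Nat.eq_of_beq_eq_true hp
  have hq' : c &&& q.1 = q.2 := Nat.eq_of_beq_eq_true hq
  have h : p.2 &&& q.1 = q.2 &&& p.1 := by
    rw [← hp', ← hq', Nat.and_assoc, Nat.and_assoc, Nat.and_comm p.1]
  exact Nat.beq_eq.symm ▸ h

/-- Every cover of the cells by at most `n` more columns is a prism cover. -/
def searchCovers : ℕ → List (ℕ × ℕ) → List ℕ → Bool
  | _, [], l => isPrismCover l
  | 0, _ :: _, _ => true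
  | n + 1, p :: rem, l => (Nat.beq n 0 && rem.any fun q => !compatibleCells p q) ||
      (List.range 64).all fun c =>
        !coversCell c p || searchCovers n (rem.filter fun q => !coversCell c q) (c :: l)

theorem searchCovers_eq_true : searchCovers 5 cellCodes [] = true := by
  decide +kernel

theorem colCode_spec : ∀ c : Fin 6 → Bool, colCode c < 64 ∧
    (∀ j : Fin 6, (colCode c).testBit j = c j) ∧ ∀ j k : Fin 6, k ≠ j → k ≠ j + 1 →
      coversCell (colCode c) (cellCode j k) = (c j && c (j + 1) && !c k) := by
  decide +kernel

theorem mem_cellCodes_iff : ∀ p : ℕ × ℕ, p ∈ cellCodes →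
    ∃ j k : Fin 6, k ≠ j ∧ k ≠ j + 1 ∧ p = cellCode j k := by
  decide +kernel

theorem isPrismCover_of_searchCovers {D : Finset ℕ} (hD : ∀ c ∈ D, c < 64) (hcard : D.card ≤ 5)
    (n : ℕ) (rem : List (ℕ × ℕ)) (l : List ℕ) (hs : searchCovers n rem l = true)
    (hn : n + l.length = 5) (hl : l.Nodup) (hlD : ∀ c ∈ l, c ∈ D)
    (hrem : ∀ p ∈ rem, ∀ c ∈ l, coversCell c p = false)
    (hcov : ∀ p ∈ rem, ∃ c ∈ D, coversCell c p = true) :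
    ∃ l' : List ℕ, (∀ c ∈ l', c ∈ D) ∧ isPrismCover l' = true := by
  have hlen : ∀ l' : List ℕ, l'.Nodup → (∀ c ∈ l', c ∈ D) → l'.length ≤ 5 := by
    intro l' hl' hD'
    rw [← List.toFinset_card_of_nodup hl']
    exact (Finset.card_le_card fun x hx => hD' x (List.mem_toFinset.1 hx)).trans hcard
  induction n generalizing rem l with
  | zero =>
    cases rem with
    | nil => exact ⟨l, hlD, by simpa [searchCovers] using hs⟩
    | cons p rem =>
      exfalso
      obtain ⟨c, hc, hcp⟩ := hcov p (by simp)
      have hcl : c ∉ l := fun h => by simp [hrem p (by simp) c h] at hcp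
      have := hlen (c :: l) (List.nodup_cons.2 ⟨hcl, hl⟩) (List.forall_mem_cons.2 ⟨hc, hlD⟩)
      rw [List.length_cons] at this
      omega
  | succ n ih =>
    cases rem with
    | nil => exact ⟨l, hlD, by simpa [searchCovers] using hs⟩
    | cons p rem =>
      obtain ⟨c, hc, hcp⟩ := hcov p (by simp)
      have hcl : c ∉ l := fun h => by simp [hrem p (by simp) c h] at hcp
      rw [searchCovers, Bool.or_eq_true] at hs
      rcases hs with hs | hs
      · exfalso
        rw [Bool.and_eq_true, List.any_eq_true] at hs
        obtain ⟨hn0, q, hq, hpq⟩ := hs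
        have hn0' : n = 0 := Nat.eq_of_beq_eq_true hn0
        obtain ⟨d, hd, hdq⟩ := hcov q (by simp [hq])
        have hdl : d ∉ l := fun h => by simp [hrem q (by simp [hq]) d h] at hdq
        have hdc : c ≠ d := by
          rintro rfl
          simp [compatibleCells_of_coversCell hcp hdq] at hpq
        have := hlen (c :: d :: l)
          (List.nodup_cons.2 ⟨by simp [hdc, hcl], List.nodup_cons.2 ⟨hdl, hl⟩⟩)
          (List.forall_mem_cons.2 ⟨hc, List.forall_mem_cons.2 ⟨hd, hlD⟩⟩)
        rw [List.length_cons, List.length_cons] at this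
        omega
      simp only [List.all_eq_true, List.mem_range] at hs
      have hs' := hs c (hD c hc)
      rw [hcp] at hs'
      refine ih _ (c :: l) (by simpa using hs') (by simp; omega)
        (List.nodup_cons.2 ⟨hcl, hl⟩) ?_ ?_ ?_
      · exact List.forall_mem_cons.2 ⟨hc, hlD⟩
      · intro q hq x hx
        rw [List.mem_filter] at hq
        rcases List.mem_cons.1 hx with rfl | h
        · simpa using hq.2
        · exact hrem q (by simp [hq.1]) x h
      · intro q hq
        rw [List.mem_filter] at hq
        exact hcov q (by simp [hq.1])

/-- Five subsets of a 6-cycle such that every edge is separated from every vertex off that edge by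
a subset containing the edge form the facets of a prism. -/
theorem exists_prism_pattern (C : Fin 5 → Fin 6 → Bool)
    (h : ∀ j k : Fin 6, k ≠ j → k ≠ j + 1 → ∃ i, C i j = true ∧ C i (j + 1) = true ∧
      C i k = false) :
    ∃ (r : Fin 6) (σ : Fin 5 → Fin 5), Function.Bijective σ ∧
      ∀ m j, C (σ m) (j + r) = prismColumn m j := by
  classical
  obtain ⟨l, hl, hcov⟩ := isPrismCover_of_searchCovers
    (D := Finset.univ.image fun i => colCode (C i))
    (by
      intro c hc
      obtain ⟨i, -, rfl⟩ := Finset.mem_image.1 hc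
      exact (colCode_spec _).1)
    (Finset.card_image_le.trans (by simp)) 5 cellCodes [] searchCovers_eq_true rfl
    List.nodup_nil (by simp) (by simp)
    (by
      intro p hp
      obtain ⟨j, k, h1, h2, rfl⟩ := mem_cellCodes_iff p hp
      obtain ⟨i, h3, h4, h5⟩ := h j k h1 h2
      exact ⟨_, Finset.mem_image_of_mem _ (Finset.mem_univ i), by
        rw [(colCode_spec _).2.2 j k h1 h2, h3, h4, h5]; rfl⟩)
  obtain ⟨r, hr⟩ := of_decide_eq_true hcov
  have : ∀ m, ∃ i, colCode (C i) = colCode (fun j => prismColumn m (j - r)) := by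
    intro m
    simpa using hl _ (hr m)
  choose σ hσ using this
  have hval : ∀ m j, C (σ m) (j + r) = prismColumn m j := by
    intro m j
    rw [← (colCode_spec (C (σ m))).2.1, hσ, (colCode_spec _).2.1, add_sub_cancel_right]
  refine ⟨r, σ, Finite.injective_iff_bijective.1 ?_, hval⟩
  intro m m' hm
  have hcol : ∀ j, prismColumn m j = prismColumn m' j := by
    intro j
    rw [← hval, ← hval, hm]
  revert m m'
  have : ∀ m m' : Fin 5, (∀ j, prismColumn m j = prismColumn m' j) → m = m' := by decide
  exact fun m m' _ => this m m'

theorem IsVertexOf.exists_functional {N : ℕ} {P : Set (Fin N → ℝ)} {v : Fin N → ℝ}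
    (hv : IsVertexOf v P) : v ∈ P ∧ ∃ f : (Fin N → ℝ) →ᵃ[ℝ] ℝ, (∀ x ∈ P, 0 ≤ f x) ∧ f v = 0 ∧
      ∀ x ∈ P, x ≠ v → 0 < f x := by
  obtain ⟨f, hf, hvf⟩ := isFaceOf_iff.1 hv
  have hmem : v ∈ {x ∈ P | f x = 0} := hvf ▸ mem_singleton v
  refine ⟨hmem.1, f, hf, hmem.2, fun x hx hne => lt_of_le_of_ne (hf x hx) fun h0 => hne ?_⟩
  have : x ∈ ({v} : Set (Fin N → ℝ)) := hvf ▸ ⟨hx, h0.symm⟩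
  exact this

/-- A vertex is not in a triangle spanned by other points. -/
theorem IsVertexOf.one_lt_add {N : ℕ} {P : Set (Fin N → ℝ)} {v w₀ w₁ w₂ : Fin N → ℝ}
    (hv : IsVertexOf v P) (h₀ : w₀ ∈ P) (h₁ : w₁ ∈ P) (h₂ : w₂ ∈ P) (hn₀ : w₀ ≠ v) (hn₁ : w₁ ≠ v)
    (hn₂ : w₂ ≠ v) {a b : ℝ} (ha : 0 ≤ a) (hb : 0 ≤ b)
    (h : v - w₀ = a • (w₁ - w₀) + b • (w₂ - w₀)) : 1 < a + b := by
  obtain ⟨-, f, -, hfv, hf⟩ := hv.exists_functional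
  have e := congrArg f.linear h
  rw [map_add, map_smul, map_smul, AffineMap.linear_sub_apply, AffineMap.linear_sub_apply,
    AffineMap.linear_sub_apply, hfv, smul_eq_mul, smul_eq_mul] at e
  have e0 := hf _ h₀ hn₀
  have e1 := hf _ h₁ hn₁
  have e2 := hf _ h₂ hn₂
  by_contra hcon
  push Not at hcon
  have i1 : 0 ≤ a * f w₁ := by positivity
  have i2 : 0 ≤ b * f w₂ := by positivity
  have i3 : 0 ≤ (1 - (a + b)) * f w₀ := mul_nonneg (by linarith) e0.le
  have i4 : a = 0 ∧ b = 0 := by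
    constructor
    · by_contra hne
      have : 0 < a * f w₁ := by positivity
      linarith
    · by_contra hne
      have : 0 < b * f w₂ := by positivity
      linarith
  rw [i4.1, i4.2] at e
  linarith

theorem exists_functional_separating {E : Type*} [AddCommGroup E] [Module ℝ E]
    [FiniteDimensional ℝ E] {D : Submodule ℝ E} (hD : Module.finrank ℝ D = 2) {φ : E →ₗ[ℝ] ℝ}
    {w : E} (hw : w ∈ D) (hφw : φ w ≠ 0) :
    ∃ g : E →ₗ[ℝ] ℝ, ∀ u ∈ D, φ u = 0 → g u = 0 → u = 0 := by
  have hlt : D ⊓ LinearMap.ker φ < D := by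
    refine lt_of_le_of_ne inf_le_left fun h => hφw ?_
    have : w ∈ D ⊓ LinearMap.ker φ := by rw [h]; exact hw
    exact this.2
  have hfr := Submodule.finrank_lt_finrank_of_lt hlt
  obtain ⟨v, hv⟩ := finrank_le_one_iff.1
    (show Module.finrank ℝ (D ⊓ LinearMap.ker φ : Submodule ℝ E) ≤ 1 by omega)
  obtain ⟨g, hg⟩ : ∃ g : E →ₗ[ℝ] ℝ, (v : E) ≠ 0 → g v ≠ 0 := by
    by_cases h0 : (v : E) = 0
    · exact ⟨0, fun h => absurd h0 h⟩
    · obtain ⟨g, hg, -⟩ := Submodule.exists_le_ker_of_notMem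
        (p := (⊥ : Submodule ℝ E)) (v := (v : E)) (by simpa using h0)
      exact ⟨g, fun _ => hg⟩
  refine ⟨g, fun u hu h1 h2 => ?_⟩
  obtain ⟨c, hc⟩ := hv ⟨u, hu, h1⟩
  have hc' : c • (v : E) = u := congrArg Subtype.val hc
  by_cases h0 : (v : E) = 0
  · rw [← hc', h0, smul_zero]
  · rw [← hc', map_smul, smul_eq_mul] at h2
    rcases mul_eq_zero.1 h2 with h | h
    · rw [← hc', h, zero_smul]
    · exact absurd h (hg h0)

/-- The signed area of a triangle in terms of two affine coordinates. -/
def orientation {E : Type*} (X Y : E → ℝ) (a b c : E) : ℝ :=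
  (X a * Y b - Y a * X b) + (X b * Y c - Y b * X c) + (X c * Y a - Y c * X a)

theorem exists_orientation_pos {N : ℕ} {P : Set (Fin N → ℝ)}
    (hP : IsPolytope P) (hdP : pdim P = 2) (hv : vertexCount P = 6) :
    ∃ (p : Fin 6 → (Fin N → ℝ)) (X Y : (Fin N → ℝ) →ᵃ[ℝ] ℝ), Function.Injective p ∧
      range p = vertexSet P ∧ ∀ i j k, i < j → j < k → 0 < orientation X Y (p i) (p j) (p k) := by
  classical
  obtain ⟨S, hS, hSv⟩ := hP.exists_vertexSet
  have hcard : S.card = 6 := by rw [← hv, vertexCount, hSv, ncard_coe_finset]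
  have hver : ∀ s ∈ S, IsVertexOf s P := fun s hs => by
    have : s ∈ vertexSet P := hSv ▸ hs
    exact this
  have hSP : ∀ s ∈ S, s ∈ P := fun s hs => (hver s hs).exists_functional.1
  obtain ⟨v0, hv0⟩ : S.Nonempty := Finset.card_pos.1 (by omega)
  obtain ⟨hv0P, X, hX0, hXv, hXpos⟩ := (hver v0 hv0).exists_functional
  have hPne : P.Nonempty := ⟨v0, hv0P⟩
  have hcT : (S.erase v0).card = 5 := by rw [Finset.card_erase_of_mem hv0, hcard]
  have hfr : Module.finrank ℝ (vectorSpan ℝ P) = 2 := by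
    rw [pdim_of_nonempty hPne] at hdP
    exact_mod_cast hdP
  obtain ⟨w, hw⟩ : (S.erase v0).Nonempty := Finset.card_pos.1 (by omega)
  rw [Finset.mem_erase] at hw
  obtain ⟨g, hg⟩ := exists_functional_separating hfr (φ := X.linear) (w := w - v0)
    (vsub_mem_vectorSpan ℝ (hSP w hw.2) hv0P)
    (by
      rw [AffineMap.linear_sub_apply, hXv, sub_zero]
      exact (hXpos w (hSP w hw.2) hw.1).ne')
  set Y : (Fin N → ℝ) →ᵃ[ℝ] ℝ := g.toAffineMap - AffineMap.const ℝ _ (g v0) with hY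
  have hgY : ∀ x, g (x - v0) = Y x := fun x => by simp [hY]
  have hXX : ∀ x, X.linear (x - v0) = X x := fun x => by
    rw [AffineMap.linear_sub_apply, hXv, sub_zero]
  have hcombo : ∀ x ∈ P, ∀ y ∈ P, ∀ z ∈ P, ∀ a b : ℝ, X x = a * X y + b * X z →
      Y x = a * Y y + b * Y z → x - v0 = a • (y - v0) + b • (z - v0) := by
    intro x hx y hy z hz a b h1 h2
    have hmem : ∀ t ∈ P, t - v0 ∈ vectorSpan ℝ P := fun t ht => vsub_mem_vectorSpan ℝ ht hv0P
    refine sub_eq_zero.1 (hg _ (Submodule.sub_mem _ (hmem x hx) (Submodule.add_mem _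
      (Submodule.smul_mem _ _ (hmem y hy)) (Submodule.smul_mem _ _ (hmem z hz)))) ?_ ?_)
    · simp only [map_sub, map_add, map_smul, smul_eq_mul] at hXX ⊢
      rw [hXX, hXX, hXX, h1]; ring
    · simp only [map_sub, map_add, map_smul, smul_eq_mul] at hgY ⊢
      rw [hgY, hgY, hgY, h2]; ring
  have hTP : ∀ s ∈ S.erase v0, s ∈ P ∧ 0 < X s ∧ IsVertexOf s P ∧ s ≠ v0 := fun s hs => by
    rw [Finset.mem_erase] at hs
    exact ⟨hSP s hs.2, hXpos s (hSP s hs.2) hs.1, hver s hs.2, hs.1⟩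
  have hslope : ∀ s ∈ S.erase v0, ∀ t ∈ S.erase v0, s ≠ t → Y s * X t = Y t * X s →
      1 < X s / X t := by
    intro s hs t ht hst heq
    obtain ⟨hsP, hsX, hsv, hs0⟩ := hTP s hs
    obtain ⟨htP, htX, htv, ht0⟩ := hTP t ht
    have := hcombo s hsP t htP t htP (X s / X t) 0 (by field_simp; ring)
      (by field_simp; linarith)
    have h2 := hsv.one_lt_add hv0P htP htP hs0.symm hst.symm hst.symm (by positivity) le_rfl this
    simpa using h2
  have hinj : InjOn (fun s => Y s / X s) (S.erase v0 : Finset (Fin N → ℝ)) := by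
    intro s hs t ht h
    by_contra hst
    have hsX := (hTP s hs).2.1
    have htX := (hTP t ht).2.1
    have h' : Y s * X t = Y t * X s := by
      dsimp only at h
      rwa [div_eq_div_iff hsX.ne' htX.ne'] at h
    have h1 := hslope s hs t ht hst h'
    have h2 := hslope t ht s hs (Ne.symm hst) h'.symm
    rw [one_lt_div htX] at h1
    rw [one_lt_div hsX] at h2
    linarith
  have hci : ((S.erase v0).image fun s => Y s / X s).card = 5 := by
    rw [Finset.card_image_of_injOn hinj, hcT]
  have hex : ∀ i : Fin 5, ∃ s ∈ S.erase v0, Y s / X s =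
      ((S.erase v0).image fun s => Y s / X s).orderEmbOfFin hci i := fun i =>
    Finset.mem_image.1 (Finset.orderEmbOfFin_mem _ hci i)
  choose v hvT hvs using hex
  have hdet : ∀ i j : Fin 5, i < j → 0 < X (v i) * Y (v j) - Y (v i) * X (v j) := by
    intro i j hij
    have hlt : Y (v i) / X (v i) < Y (v j) / X (v j) := by
      rw [hvs, hvs]
      exact (Finset.orderEmbOfFin _ hci).strictMono hij
    have h1 := (hTP _ (hvT i)).2.1
    have h2 := (hTP _ (hvT j)).2.1
    rw [div_lt_div_iff₀ h1 h2] at hlt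
    linarith
  have hvinj : Function.Injective v := by
    intro i j hij
    have h1 := hvs i
    rw [hij, hvs j] at h1
    exact ((Finset.orderEmbOfFin _ hci).injective h1).symm
  have hpinj : Function.Injective (Fin.cons v0 v : Fin 6 → (Fin N → ℝ)) := by
    rw [Fin.cons_injective_iff]
    refine ⟨?_, hvinj⟩
    rintro ⟨i, hi⟩
    exact (hTP _ (hvT i)).2.2.2 hi
  refine ⟨Fin.cons v0 v, X, Y, hpinj, ?_, ?_⟩
  · rw [hSv]
    have hsub : Finset.univ.image (Fin.cons v0 v : Fin 6 → (Fin N → ℝ)) = S := by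
      refine Finset.eq_of_subset_of_card_le ?_ ?_
      · intro x hx
        obtain ⟨i, -, rfl⟩ := Finset.mem_image.1 hx
        refine Fin.cases ?_ (fun i => ?_) i
        · exact hv0
        · exact (Finset.mem_erase.1 (hvT i)).2
      · rw [Finset.card_image_of_injective _ hpinj, hcard]
        simp
    rw [← hsub]
    simp
  · have hY0 : Y v0 = 0 := by simp [hY]
    intro i j k hij hjk
    obtain ⟨j, rfl⟩ := Fin.exists_succ_eq.2 (Fin.ne_zero_of_lt hij)
    obtain ⟨k, rfl⟩ := Fin.exists_succ_eq.2 (Fin.ne_zero_of_lt hjk)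
    rw [Fin.succ_lt_succ_iff] at hjk
    rcases Fin.eq_zero_or_eq_succ i with rfl | ⟨i, rfl⟩
    · simp only [Fin.cons_zero, Fin.cons_succ, orientation, hXv, hY0]
      linarith [hdet j k hjk]
    · rw [Fin.succ_lt_succ_iff] at hij
      simp only [Fin.cons_succ, orientation]
      have d1 := hdet i j hij
      have d2 := hdet j k hjk
      have d3 := hdet i k (hij.trans hjk)
      have := hcombo (v j) (hTP _ (hvT j)).1 (v i) (hTP _ (hvT i)).1 (v k) (hTP _ (hvT k)).1
        ((X (v j) * Y (v k) - Y (v j) * X (v k)) / (X (v i) * Y (v k) - Y (v i) * X (v k)))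
        ((X (v i) * Y (v j) - Y (v i) * X (v j)) / (X (v i) * Y (v k) - Y (v i) * X (v k)))
        (by rw [div_mul_eq_mul_div, div_mul_eq_mul_div, ← add_div, eq_div_iff d3.ne']; ring)
        (by rw [div_mul_eq_mul_div, div_mul_eq_mul_div, ← add_div, eq_div_iff d3.ne']; ring)
      have h2 := (hTP _ (hvT j)).2.2.1.one_lt_add hv0P (hTP _ (hvT i)).1 (hTP _ (hvT k)).1
        (hTP _ (hvT j)).2.2.2.symm (fun h => hij.ne (hvinj h)) (fun h => hjk.ne' (hvinj h))
        (by positivity) (by positivity) this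
      rw [← add_div, one_lt_div d3] at h2
      linarith

theorem exists_cyclicLabeling {N : ℕ} {P : Set (Fin N → ℝ)}
    (hP : IsPolytope P) (hdP : pdim P = 2) (hv : vertexCount P = 6) :
    ∃ p, CyclicLabeling P p := by
  obtain ⟨p, X, Y, hinj, hrange, hpos⟩ := exists_orientation_pos hP hdP hv
  refine ⟨p, hinj, hrange, fun i => ?_⟩
  obtain ⟨S, hS, hSv⟩ := hP.exists_vertexSet
  rw [← hSv, ← hrange] at hS
  have hcyc : ∀ j k : Fin 6, k ≠ j → k ≠ j + 1 →
      (j < j + 1 ∧ j + 1 < k) ∨ (k < j ∧ j < j + 1) ∨ (j + 1 < k ∧ k < j) := by decide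
  set f : (Fin N → ℝ) →ᵃ[ℝ] ℝ :=
    AffineMap.const ℝ _ (X (p i) * Y (p (i + 1)) - Y (p i) * X (p (i + 1))) +
      (X (p (i + 1)) • Y - Y (p (i + 1)) • X) + (Y (p i) • X - X (p i) • Y) with hf
  have hfx : ∀ x, f x = orientation X Y (p i) (p (i + 1)) x := by
    intro x
    simp [hf, orientation]
    ring
  have hz1 : f (p i) = 0 := by rw [hfx, orientation]; ring
  have hz2 : f (p (i + 1)) = 0 := by rw [hfx, orientation]; ring
  have hfp : ∀ k, k ≠ i → k ≠ i + 1 → 0 < f (p k) := by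
    intro k h1 h2
    rw [hfx]
    rcases hcyc i k h1 h2 with ⟨h3, h4⟩ | ⟨h3, h4⟩ | ⟨h3, h4⟩
    · exact hpos _ _ _ h3 h4
    · have := hpos _ _ _ h3 h4
      unfold orientation at this ⊢
      linarith
    · have := hpos _ _ _ h3 h4
      unfold orientation at this ⊢
      linarith
  have hf0 : ∀ s ∈ range p, 0 ≤ f s := by
    rintro _ ⟨k, rfl⟩
    by_cases h1 : k = i
    · rw [h1, hz1]
    by_cases h2 : k = i + 1
    · rw [h2, hz2]
    exact (hfp k h1 h2).le
  refine isFaceOf_iff.2 ⟨f, ?_, ?_⟩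
  · rw [hS]
    exact nonneg_of_mem_convexHull hf0
  · rw [hS, zeroLocus_convexHull hf0, ← convexHull_pair]
    congr 1
    ext x
    constructor
    · rintro (rfl | rfl)
      · exact ⟨mem_range_self _, hz1⟩
      · exact ⟨mem_range_self _, hz2⟩
    · rintro ⟨⟨k, rfl⟩, hk⟩
      by_cases h1 : k = i
      · exact Or.inl (by rw [h1])
      by_cases h2 : k = i + 1
      · exact Or.inr (by rw [h2]; rfl)
      exact absurd hk (hfp k h1 h2).ne'

/-- Every edge in a cyclic labeling is exposed by a functional vanishing at no other vertex. -/
theorem CyclicLabeling.exists_functional {N : ℕ} {P : Set (Fin N → ℝ)} {p : Fin 6 → (Fin N → ℝ)}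
    (h : CyclicLabeling P p) (j : Fin 6) :
    ∃ f : (Fin N → ℝ) →ᵃ[ℝ] ℝ, (∀ x ∈ P, 0 ≤ f x) ∧ f (p j) = 0 ∧ f (p (j + 1)) = 0 ∧
      ∀ k, k ≠ j → k ≠ j + 1 → 0 < f (p k) := by
  obtain ⟨hinj, hrange, hface⟩ := h
  obtain ⟨f, hf, hseg⟩ := isFaceOf_iff.1 (hface j)
  have hver : ∀ k, IsVertexOf (p k) P := fun k => by
    have : p k ∈ vertexSet P := hrange ▸ mem_range_self k
    exact this
  have h1 : p j ∈ {x ∈ P | f x = 0} := hseg ▸ left_mem_segment ℝ _ _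
  have h2 : p (j + 1) ∈ {x ∈ P | f x = 0} := hseg ▸ right_mem_segment ℝ _ _
  refine ⟨f, hf, h1.2, h2.2, fun k hk1 hk2 => ?_⟩
  obtain ⟨hkP, g, -, hgk, hg⟩ := (hver k).exists_functional
  refine lt_of_le_of_ne (hf _ hkP) fun h0 => ?_
  have hmem : p k ∈ segment ℝ (p j) (p (j + 1)) := hseg ▸ ⟨hkP, h0.symm⟩
  obtain ⟨a, b, ha, hb, hab, hk⟩ := hmem
  have e1 := hg _ h1.1 (fun h => hk1 (hinj h).symm)
  have e2 := hg _ h2.1 (fun h => hk2 (hinj h).symm)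
  rw [← hk, affineMap_convex_combo g _ _ hab] at hgk
  rcases ha.eq_or_lt with rfl | ha
  · have : b = 1 := by linarith
    subst this
    linarith
  · have : 0 < a * g (p j) := by positivity
    have : 0 ≤ b * g (p (j + 1)) := by positivity
    linarith

theorem exists_pos_forall_nonneg_add_smul {E ι : Type*} [AddCommGroup E] [Module ℝ E] [Finite ι]
    {l : ι → E →ᵃ[ℝ] ℝ} {m u : E} (hm : ∀ i, 0 ≤ l i m)
    (hu : ∀ i, l i m = 0 → 0 ≤ (l i).linear u) :
    ∃ ε : ℝ, 0 < ε ∧ ∀ i, 0 ≤ l i (m + ε • u) := by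
  have key : ∀ᶠ ε in nhdsWithin (0 : ℝ) (Ioi 0), 0 < ε ∧ ∀ i, 0 ≤ l i (m + ε • u) := by
    refine (eventually_mem_nhdsWithin).and (Filter.eventually_all.2 fun i => ?_)
    simp only [AffineMap.map_add_smul]
    rcases (hm i).eq_or_lt with h0 | h0
    · filter_upwards [eventually_mem_nhdsWithin] with ε hε
      rw [← h0, zero_add]
      exact mul_nonneg (le_of_lt hε) (hu i h0.symm)
    · have hc : ContinuousAt (fun ε : ℝ => l i m + ε * (l i).linear u) 0 := by fun_prop
      have h1 : ∀ᶠ ε in nhds (0 : ℝ), 0 < l i m + ε * (l i).linear u :=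
        hc.eventually (lt_mem_nhds (by simpa using h0))
      exact (h1.filter_mono nhdsWithin_le_nhds).mono fun _ h => h.le
  exact key.exists

section Inequalities

variable {E ι : Type*} [AddCommGroup E] [Module ℝ E] [Finite ι] {Q : Set E} {l : ι → E →ᵃ[ℝ] ℝ}

theorem exists_add_smul_mem (hl : ∀ y ∈ Q, ∀ i, 0 ≤ l i y)
    (hQ : ∀ y ∈ affineSpan ℝ Q, (∀ i, 0 ≤ l i y) → y ∈ Q) {m u : E} (hm : m ∈ Q)
    (hu : u ∈ vectorSpan ℝ Q) (hz : ∀ i, l i m = 0 → 0 ≤ (l i).linear u) :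
    ∃ ε : ℝ, 0 < ε ∧ m + ε • u ∈ Q := by
  obtain ⟨ε, hε, h⟩ := exists_pos_forall_nonneg_add_smul (hl m hm) hz
  refine ⟨ε, hε, hQ _ ?_ h⟩
  rw [add_comm]
  exact AffineSubspace.vadd_mem_of_mem_direction
    (by rw [direction_affineSpan]; exact Submodule.smul_mem _ _ hu) (subset_affineSpan ℝ _ hm)

theorem eq_zero_of_tight_subset (hl : ∀ y ∈ Q, ∀ i, 0 ≤ l i y)
    (hQ : ∀ y ∈ affineSpan ℝ Q, (∀ i, 0 ≤ l i y) → y ∈ Q) {f : E →ᵃ[ℝ] ℝ} (hf : ∀ y ∈ Q, 0 ≤ f y)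
    {m y : E} (hm : m ∈ Q) (hy : y ∈ Q) (hfm : f m = 0) (hz : ∀ i, l i m = 0 → l i y = 0) :
    f y = 0 := by
  obtain ⟨ε, hε, h⟩ := exists_add_smul_mem hl hQ hm (vsub_mem_vectorSpan ℝ hm hy) (fun i hi => by
    rw [vsub_eq_sub, AffineMap.linear_sub_apply, hi, hz i hi, sub_zero])
  have h1 := hf _ h
  rw [AffineMap.map_add_smul, vsub_eq_sub, AffineMap.linear_sub_apply, hfm] at h1
  have h2 := hf y hy
  nlinarith

/-- At a point exposed by a functional, the tight inequalities determine directions. -/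
theorem eq_zero_of_linear_eq_zero (hl : ∀ y ∈ Q, ∀ i, 0 ≤ l i y)
    (hQ : ∀ y ∈ affineSpan ℝ Q, (∀ i, 0 ≤ l i y) → y ∈ Q) {f : E →ᵃ[ℝ] ℝ} {m u : E} (hm : m ∈ Q)
    (hfm : f m = 0) (hf : ∀ y ∈ Q, y ≠ m → 0 < f y) (hu : u ∈ vectorSpan ℝ Q)
    (hz : ∀ i, l i m = 0 → (l i).linear u = 0) : u = 0 := by
  obtain ⟨ε, hε, h⟩ := exists_add_smul_mem hl hQ hm hu (fun i hi => (hz i hi).ge)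
  obtain ⟨η, hη, h'⟩ := exists_add_smul_mem hl hQ hm (neg_mem hu) (fun i hi => by
    rw [map_neg, hz i hi, neg_zero])
  by_contra hne
  have h1 := hf _ h (by simp [hε.ne', hne])
  have h2 := hf _ h' (by simp [hη.ne', hne])
  rw [AffineMap.map_add_smul, hfm, zero_add] at h1 h2
  rw [map_neg] at h2
  have := pos_of_mul_pos_right h1 hε.le
  have := pos_of_mul_pos_right h2 hη.le
  linarith

end Inequalities

theorem IsPolytope.exists_vertex_lift {M N : ℕ} {Q : Set (Fin M → ℝ)} (hQ : IsPolytope Q)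
    {π : (Fin M → ℝ) →ᵃ[ℝ] (Fin N → ℝ)} {v : Fin N → ℝ} (hv : IsVertexOf v (π '' Q)) :
    ∃ y, IsVertexOf y Q ∧ π y = v := by
  obtain ⟨S, hS, hvS⟩ := hQ.exists_vertexSet
  obtain ⟨hvP, f, hf, hfv, hf'⟩ := hv.exists_functional
  obtain ⟨x, hx, rfl⟩ := hvP
  have h0 : ∀ s ∈ (S : Set (Fin M → ℝ)), 0 ≤ (f.comp π) s := fun s hs =>
    hf _ (mem_image_of_mem _ (hS ▸ subset_convexHull ℝ _ hs))
  have hxm : x ∈ {x ∈ convexHull ℝ (S : Set (Fin M → ℝ)) | (f.comp π) x = 0} := ⟨hS ▸ hx, hfv⟩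
  rw [zeroLocus_convexHull h0] at hxm
  obtain ⟨s, hs, hs0⟩ := convexHull_nonempty_iff.1 ⟨x, hxm⟩
  refine ⟨s, ?_, ?_⟩
  · rw [← hvS] at hs
    exact hs
  · by_contra hne
    exact (hf' _ (mem_image_of_mem _ (hS ▸ subset_convexHull ℝ _ hs)) hne).ne' hs0

theorem CyclicLabeling.rotate {N : ℕ} {P : Set (Fin N → ℝ)} {p : Fin 6 → (Fin N → ℝ)}
    (h : CyclicLabeling P p) (r : Fin 6) : CyclicLabeling P (fun j => p (j + r)) := by
  refine ⟨h.1.comp (add_left_injective r), ?_, fun i => ?_⟩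
  · rw [← h.2.1]
    exact (Equiv.addRight r).surjective.range_comp p
  · have := h.2.2 (i + r)
    rwa [add_right_comm] at this

/-- Three lines with direction vectors proportional to `w + ν • p i` are concurrent. -/
theorem concurrentLines_of_smul_sub {N : ℕ} {p q : Fin 3 → (Fin N → ℝ)} {β : Fin 3 → ℝ}
    (hβ : ∀ i, β i ≠ 0) {ν : ℝ} {w : Fin N → ℝ} (h : ∀ i, β i • (q i - p i) - ν • p i = w) :
    ConcurrentLines (affineSpan ℝ {p 0, q 0}) (affineSpan ℝ {p 1, q 1})
      (affineSpan ℝ {p 2, q 2}) := by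
  by_cases hν : ν = 0
  · have key : ∀ i, vectorSpan ℝ {p i, q i} = Submodule.span ℝ {w} := by
      intro i
      have hi : q i - p i = (β i)⁻¹ • w := by
        rw [← h i, hν, zero_smul, sub_zero, inv_smul_smul₀ (hβ i)]
      rw [vectorSpan_pair_rev, vsub_eq_sub, hi,
        Submodule.span_singleton_smul_eq (inv_ne_zero (hβ i)).isUnit]
    right
    simp only [AffineSubspace.affineSpan_pair_parallel_iff_vectorSpan_eq, key, and_self]
  · have key : ∀ i, -(ν⁻¹ • w) ∈ affineSpan ℝ {p i, q i} := by
      intro i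
      have : -(ν⁻¹ • w) = AffineMap.lineMap (p i) (q i) (-(ν⁻¹ * β i)) := by
        rw [AffineMap.lineMap_apply, vsub_eq_sub, vadd_eq_add, ← h i, smul_sub, inv_smul_smul₀ hν,
          smul_smul, neg_smul]
        abel
      rw [this]
      exact AffineMap.lineMap_mem_affineSpan_pair _ _ _
    exact Or.inl ⟨_, key 0, key 1, key 2⟩

/-- In a triangular prism, the three edges joining the two triangles lie on concurrent lines. -/
theorem exists_forall_smul_sub_eq {E : Type*} [AddCommGroup E] [Module ℝ E] {V : Submodule ℝ E}
    {a b : Fin 3 → E} {α : E →ᵃ[ℝ] ℝ} {l : Fin 3 → E →ᵃ[ℝ] ℝ}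
    (hab : ∀ i, b i - a i ∈ V) (haa : ∀ i j, a i - a j ∈ V)
    (ha : ∀ i, α (a i) = 0) (hb : ∀ i, 0 < α (b i))
    (hla : ∀ i k, k ≠ i → l k (a i) = 0) (hlb : ∀ i k, k ≠ i → l k (b i) = 0)
    (hl : ∀ i, 0 < l i (a i))
    (hrigid : ∀ i, ∀ u ∈ V, α.linear u = 0 → (∀ k, k ≠ i → (l k).linear u = 0) → u = 0) :
    ∃ ν : ℝ, ∀ i j, (α (b i))⁻¹ • (b i - a i) - (α (b j))⁻¹ • (b j - a j) = ν • (a i - a j) := by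
  set δ : Fin 3 → E := fun i => (α (b i))⁻¹ • (b i - a i) with hδ
  set c : Fin 3 → ℝ := fun j => (l j).linear (δ j) / l j (a j) with hc
  have hαδ : ∀ i, α.linear (δ i) = 1 := by
    intro i
    simp only [hδ, map_smul, AffineMap.linear_sub_apply, ha, sub_zero, smul_eq_mul]
    exact inv_mul_cancel₀ (hb i).ne'
  have hlδ : ∀ i k, k ≠ i → (l k).linear (δ i) = 0 := by
    intro i k hk
    simp [hδ, AffineMap.linear_sub_apply, hla i k hk, hlb i k hk]
  have hstep : ∀ i j, i ≠ j → δ i - δ j = c j • (a i - a j) := by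
    intro i j hij
    rw [← sub_eq_zero]
    refine hrigid i _ (sub_mem (sub_mem (Submodule.smul_mem _ _ (hab i))
      (Submodule.smul_mem _ _ (hab j))) (Submodule.smul_mem _ _ (haa i j))) ?_ ?_
    · simp only [map_sub, map_smul, hαδ]
      rw [← map_sub, AffineMap.linear_sub_apply, ha, ha]
      simp
    · intro k hk
      rw [map_sub, map_sub, map_smul _ (c j), AffineMap.linear_sub_apply _ (a i), hlδ i k hk, hla i k hk]
      by_cases hkj : k = j
      · subst hkj
        simp only [hc, smul_eq_mul]
        have := (hl k).ne'
        field_simp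
        ring
      · rw [hlδ j k hkj, hla j k hkj]
        simp
  have hcc : ∀ i j, c i = c j := by
    intro i j
    by_cases hij : i = j
    · rw [hij]
    have h1 := hstep i j hij
    have h2 := hstep j i (Ne.symm hij)
    have h3 : (c i - c j) • (a i - a j) = 0 := by
      rw [sub_smul, ← h1, ← neg_sub (a j) (a i), smul_neg, ← h2]
      abel
    rcases smul_eq_zero.1 h3 with h | h
    · linarith
    · have h4 := hl i
      rw [sub_eq_zero.1 h, hla j i hij] at h4
      exact absurd h4 (lt_irrefl _)
  refine ⟨c 0, fun i j => ?_⟩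
  by_cases hij : i = j
  · subst hij
    simp
  · rw [hcc 0 j]
    exact hstep i j hij

theorem desarguian_of_extension {M N : ℕ} {Q : Set (Fin M → ℝ)} {P : Set (Fin N → ℝ)}
    {π : (Fin M → ℝ) →ᵃ[ℝ] (Fin N → ℝ)} (hQ : IsPolytope Q) (hπ : π '' Q = P) (hP : IsHexagon P)
    (h5 : facetCount Q ≤ 5) : facetCount Q = 5 ∧ Desarguian P := by
  obtain ⟨p, hp⟩ := exists_cyclicLabeling hP.1 hP.2.1 hP.2.2
  have hlift : ∀ j, ∃ y, IsVertexOf y Q ∧ π y = p j := fun j =>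
    hQ.exists_vertex_lift (by
      have : p j ∈ vertexSet P := hp.2.1 ▸ mem_range_self j
      rwa [← hπ] at this)
  choose y hyv hyp using hlift
  have hyQ : ∀ j, y j ∈ Q := fun j => (hyv j).exists_functional.1
  have hd : 1 ≤ pdim Q := by
    rw [pdim_of_nonempty ⟨_, hyQ 0⟩]
    have hne : y 0 - y 1 ≠ 0 := by
      intro h
      have := congrArg π (sub_eq_zero.1 h)
      rw [hyp, hyp] at this
      exact absurd (hp.1 this) (by decide)
    have : vectorSpan ℝ Q ≠ ⊥ := fun h => hne ((Submodule.mem_bot ℝ).1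
      (h ▸ vsub_mem_vectorSpan ℝ (hyQ 0) (hyQ 1)))
    have := Submodule.one_le_finrank_iff.2 this
    exact_mod_cast this
  obtain ⟨l, hl, hlQ, hlt⟩ := exists_five_inequalities hQ hd h5
  obtain ⟨r, σ, hσ, hpat⟩ := exists_prism_pattern (fun i j => decide (l i (y j) = 0)) (by
    intro j k hk1 hk2
    obtain ⟨g, hg, hgj, hgj1, hgk⟩ := hp.exists_functional j
    by_contra hcon
    have hz : ∀ i, l i (y j) = 0 → l i (y (j + 1)) = 0 → l i (y k) = 0 := by
      intro i h1 h2
      by_contra h3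
      exact hcon ⟨i, by simpa using h1, by simpa using h2, by simpa using h3⟩
    have hmQ : (1 / 2 : ℝ) • y j + (1 / 2 : ℝ) • y (j + 1) ∈ Q := by
      obtain ⟨S, rfl⟩ := hQ
      exact convex_convexHull ℝ _ (hyQ j) (hyQ (j + 1)) (by norm_num) (by norm_num) (by norm_num)
    have hgπ : ∀ x ∈ Q, 0 ≤ (g.comp π) x := fun x hx => hg _ (hπ ▸ mem_image_of_mem _ hx)
    have := eq_zero_of_tight_subset hl hlQ hgπ hmQ (hyQ k) (by
      rw [affineMap_convex_combo _ _ _ (by norm_num)]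
      simp [hyp, hgj, hgj1]) (fun i hi => by
        rw [affineMap_convex_combo _ _ _ (by norm_num)] at hi
        have h1 := hl _ (hyQ j) i
        have h2 := hl _ (hyQ (j + 1)) i
        exact hz i (by linarith) (by linarith))
    rw [AffineMap.comp_apply, hyp] at this
    exact (hgk k hk1 hk2).ne' this)
  have hpat' : ∀ m j, l (σ m) (y (j + r)) = 0 ↔ prismColumn m j = true := by
    intro m j
    rw [← hpat m j, decide_eq_true_iff]
  constructor
  · by_contra hne
    obtain ⟨i, hi⟩ := hlt (lt_of_le_of_ne h5 hne)
    obtain ⟨m, rfl⟩ := hσ.2 i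
    obtain ⟨j, hj⟩ : ∃ j, prismColumn m j = true := by clear hi; revert m; decide
    have := (hpat' m j).2 hj
    rw [hi] at this
    exact one_ne_zero this
  refine ⟨_, hp.rotate r, ?_⟩
  have hzero : ∀ m j, prismColumn m j = true → l (σ m) (y (j + r)) = 0 := fun m j => (hpat' m j).2
  have hpos : ∀ m j, prismColumn m j = false → 0 < l (σ m) (y (j + r)) := by
    intro m j h
    refine lt_of_le_of_ne (hl _ (hyQ _) _) fun h0 => ?_
    rw [(hpat' m j).1 h0.symm] at h
    exact Bool.noConfusion h
  set a : Fin 3 → Fin 6 := ![1, 2, 3] with ha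
  set b : Fin 3 → Fin 6 := ![0, 5, 4] with hb
  obtain ⟨ν, hν⟩ := exists_forall_smul_sub_eq (V := vectorSpan ℝ Q) (a := fun i => y (a i + r))
    (b := fun i => y (b i + r)) (α := l (σ 0)) (l := fun k => l (σ (k.natAdd 2)))
    (fun i => vsub_mem_vectorSpan ℝ (hyQ _) (hyQ _))
    (fun i j => vsub_mem_vectorSpan ℝ (hyQ _) (hyQ _))
    (fun i => hzero _ _ (by revert i; decide)) (fun i => hpos _ _ (by revert i; decide))
    (fun i k h => hzero _ _ (by revert i k; decide))
    (fun i k h => hzero _ _ (by revert i k; decide)) (fun i => hpos _ _ (by revert i; decide))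
    (by
      intro i u hu h0 h1
      obtain ⟨-, f, -, hf0, hf⟩ := (hyv (a i + r)).exists_functional
      refine eq_zero_of_linear_eq_zero hl hlQ (hyQ _) hf0 hf hu fun n hn => ?_
      obtain ⟨m, rfl⟩ := hσ.2 n
      have hm := (hpat' _ _).1 hn
      have hcase : ∀ (i : Fin 3) (m : Fin 5), prismColumn m (a i) = true →
          m = 0 ∨ ∃ k : Fin 3, k ≠ i ∧ m = k.natAdd 2 := by decide
      rcases hcase i m hm with rfl | ⟨k, hk, rfl⟩
      · exact h0
      · exact h1 k hk)
  have hβ : ∀ i, (l (σ 0) (y (b i + r)))⁻¹ ≠ 0 := fun i =>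
    inv_ne_zero (hpos _ _ (by revert i; decide)).ne'
  have := concurrentLines_of_smul_sub (p := fun i => p (a i + r)) (q := fun i => p (b i + r)) hβ
    (ν := ν) (w := (l (σ 0) (y (b 0 + r)))⁻¹ • (p (b 0 + r) - p (a 0 + r)) - ν • p (a 0 + r)) (by
      intro i
      have := congrArg π.linear (hν i 0)
      simp only [map_sub, map_smul] at this
      simp only [← map_sub, AffineMap.linear_sub_apply, hyp] at this
      rw [smul_sub ν] at this
      rw [sub_eq_sub_iff_add_eq_add] at this ⊢
      rw [this, add_comm])
  simp only [ha, hb] at this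
  simpa [pair_comm] using this

/-- The vertex sets of faces of a polytope whose vertices `V` and defining inequalities `K` have
incidence relation `I`. -/
def IsFaceVertexSet {V K : Type*} (I : K → V → Prop) (A : Set V) : Prop :=
  A = ∅ ∨ ∃ T : Set K, A = {v | ∀ k ∈ T, I k v}

section FaceLattice

variable {V K : Type*} {M : ℕ} {Q : Set (Fin M → ℝ)} {x : V → (Fin M → ℝ)}
  {l : K → (Fin M → ℝ) →ᵃ[ℝ] ℝ} {I : K → V → Prop}

theorem IsFaceOf.eq_convexHull_image (hQ : Q = convexHull ℝ (range x)) {F : Set (Fin M → ℝ)}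
    (hF : IsFaceOf F Q) : F = convexHull ℝ (x '' {v | x v ∈ F}) := by
  subst hQ
  conv_lhs => rw [hF.eq_convexHull]
  congr 1
  ext y
  constructor
  · rintro ⟨hy, v, rfl⟩
    exact ⟨v, hy, rfl⟩
  · rintro ⟨v, hv, rfl⟩
    exact ⟨hv, v, rfl⟩

theorem IsFaceOf.isFaceVertexSet [Finite V] [Finite K] (hQ : Q = convexHull ℝ (range x)) (h0 : ∀ k v, 0 ≤ l k (x v))
    (hI : ∀ k v, l k (x v) = 0 ↔ I k v)
    (hH : ∀ y ∈ affineSpan ℝ Q, (∀ k, 0 ≤ l k y) → y ∈ Q) {F : Set (Fin M → ℝ)}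
    (hF : IsFaceOf F Q) : IsFaceVertexSet I {v | x v ∈ F} := by
  have := Fintype.ofFinite V
  have hxQ : ∀ v, x v ∈ Q := fun v => hQ ▸ subset_convexHull ℝ _ (mem_range_self v)
  obtain ⟨f, hf, rfl⟩ := isFaceOf_iff.1 hF
  rcases eq_empty_or_nonempty {v | x v ∈ {y ∈ Q | f y = 0}} with he | hne
  · exact Or.inl he
  right
  set A : Finset V := {v | x v ∈ {y ∈ Q | f y = 0}}.toFinite.toFinset with hA
  have hAm : ∀ v, v ∈ A ↔ f (x v) = 0 := fun v => by simp [hA, hxQ]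
  have hAne : A.Nonempty := by simpa [hA] using hne
  have hcard : (0 : ℝ) < A.card := by exact_mod_cast hAne.card_pos
  have hsum : ∑ _v ∈ A, (A.card : ℝ)⁻¹ = 1 := by
    rw [Finset.sum_const, nsmul_eq_mul, mul_inv_cancel₀ hcard.ne']
  set m := ∑ v ∈ A, (A.card : ℝ)⁻¹ • x v with hm
  have hmQ : m ∈ Q := by
    rw [hQ]
    exact (convex_convexHull ℝ _).sum_mem (fun _ _ => (inv_pos.2 hcard).le) hsum
      (fun v _ => subset_convexHull ℝ _ (mem_range_self v))
  have hgm : ∀ g : (Fin M → ℝ) →ᵃ[ℝ] ℝ, g m = ∑ v ∈ A, (A.card : ℝ)⁻¹ * g (x v) := by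
    intro g
    rw [hm, ← A.affineCombination_eq_linear_combination _ _ hsum, A.map_affineCombination _ _ hsum,
      A.affineCombination_eq_linear_combination _ _ hsum]
    rfl
  have hl : ∀ y ∈ Q, ∀ k, 0 ≤ l k y := by
    intro y hy k
    rw [hQ] at hy
    exact nonneg_of_mem_convexHull (by rintro _ ⟨v, rfl⟩; exact h0 k v) y hy
  refine ⟨{k | ∀ v ∈ A, I k v}, ?_⟩
  ext v
  constructor
  · intro hv k hk
    exact hk v ((hAm v).2 hv.2)
  · intro hv
    refine ⟨hxQ v, eq_zero_of_tight_subset hl hH hf hmQ (hxQ v) ?_ fun k hk => ?_⟩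
    · rw [hgm]
      exact Finset.sum_eq_zero fun v hv => by rw [(hAm v).1 hv, mul_zero]
    · rw [hI]
      refine hv k fun v' hv' => ?_
      rw [hgm, Finset.sum_eq_zero_iff_of_nonneg
        (fun v _ => mul_nonneg (inv_pos.2 hcard).le (h0 k v))] at hk
      exact (hI k v').1 ((mul_eq_zero.1 (hk v' hv')).resolve_left (inv_pos.2 hcard).ne')

theorem IsFaceVertexSet.exists_isFaceOf [Finite K] (hQ : Q = convexHull ℝ (range x))
    (h0 : ∀ k v, 0 ≤ l k (x v)) (hI : ∀ k v, l k (x v) = 0 ↔ I k v) {A : Set V}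
    (hA : IsFaceVertexSet I A) : ∃ F, IsFaceOf F Q ∧ {v | x v ∈ F} = A := by
  classical
  have := Fintype.ofFinite K
  have hxQ : ∀ v, x v ∈ Q := fun v => hQ ▸ subset_convexHull ℝ _ (mem_range_self v)
  rcases hA with rfl | ⟨T, rfl⟩
  · exact ⟨∅, isFaceOf_iff.2 ⟨AffineMap.const ℝ _ 1, by simp, by simp⟩, by simp⟩
  · have hl : ∀ y ∈ Q, ∀ k, 0 ≤ l k y := by
      intro y hy k
      rw [hQ] at hy
      exact nonneg_of_mem_convexHull (by rintro _ ⟨v, rfl⟩; exact h0 k v) y hy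
    set f : (Fin M → ℝ) →ᵃ[ℝ] ℝ := ∑ k ∈ T.toFinite.toFinset, l k with hf
    have hfy : ∀ y, f y = ∑ k ∈ T.toFinite.toFinset, l k y := by
      intro y
      rw [hf]
      exact map_sum (AddMonoidHom.mk' (fun g : (Fin M → ℝ) →ᵃ[ℝ] ℝ => g y) fun _ _ => rfl) _ _
    refine ⟨{y ∈ Q | f y = 0}, isFaceOf_iff.2 ⟨f, fun y hy => ?_, rfl⟩, ?_⟩
    · rw [hfy]
      exact Finset.sum_nonneg fun k _ => hl y hy k
    · ext v
      have : x v ∈ {y ∈ Q | f y = 0} ↔ f (x v) = 0 := ⟨fun h => h.2, fun h => ⟨hxQ v, h⟩⟩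
      simp only [mem_ofPred_eq] at this ⊢
      rw [this, hfy, Finset.sum_eq_zero_iff_of_nonneg (fun k _ => h0 k v)]
      simp [hI]

theorem exists_faceEquiv [Finite V] [Finite K] (hQ : Q = convexHull ℝ (range x))
    (h0 : ∀ k v, 0 ≤ l k (x v))
    (hI : ∀ k v, l k (x v) = 0 ↔ I k v)
    (hH : ∀ y ∈ affineSpan ℝ Q, (∀ k, 0 ≤ l k y) → y ∈ Q) :
    ∃ e : {F : Set (Fin M → ℝ) // IsFaceOf F Q} ≃ {A : Set V // IsFaceVertexSet I A},
      ∀ F₁ F₂, F₁.1 ⊆ F₂.1 ↔ (e F₁).1 ⊆ (e F₂).1 := by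
  set g : {F : Set (Fin M → ℝ) // IsFaceOf F Q} → {A : Set V // IsFaceVertexSet I A} :=
    fun F => ⟨{v | x v ∈ F.1}, F.2.isFaceVertexSet hQ h0 hI hH⟩ with hg
  have hord : ∀ F₁ F₂, F₁.1 ⊆ F₂.1 ↔ (g F₁).1 ⊆ (g F₂).1 := by
    intro F₁ F₂
    constructor
    · exact fun h v hv => h hv
    · intro h
      rw [F₁.2.eq_convexHull_image hQ, F₂.2.eq_convexHull_image hQ]
      exact convexHull_mono (image_mono h)
  refine ⟨Equiv.ofBijective g ⟨fun F₁ F₂ h => Subtype.ext ?_, ?_⟩, hord⟩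
  · exact ((hord F₁ F₂).2 (by rw [h])).antisymm ((hord F₂ F₁).2 (by rw [h]))
  · rintro ⟨A, hA⟩
    obtain ⟨F, hF, h⟩ := hA.exists_isFaceOf hQ h0 hI
    exact ⟨⟨F, hF⟩, Subtype.ext h⟩

end FaceLattice

theorem facetCount_le_of_faceEquiv {V K : Type*} [Finite K] [Nonempty K] {M : ℕ}
    {Q : Set (Fin M → ℝ)} {I : K → V → Prop} (hne : ∀ k, ∃ v, ¬ I k v)
    (e : {F : Set (Fin M → ℝ) // IsFaceOf F Q} ≃ {A : Set V // IsFaceVertexSet I A})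
    (he : ∀ F₁ F₂, F₁.1 ⊆ F₂.1 ↔ (e F₁).1 ⊆ (e F₂).1) : facetCount Q ≤ Nat.card K := by
  have hIface : ∀ k, IsFaceVertexSet I {v | I k v} := fun k => Or.inr ⟨{k}, by simp⟩
  set Fk : K → {F : Set (Fin M → ℝ) // IsFaceOf F Q} := fun k => e.symm ⟨_, hIface k⟩ with hFk
  have hQface : IsFaceOf Q Q := isFaceOf_iff.2 ⟨0, by simp, by simp⟩
  have htop : (e ⟨Q, hQface⟩).1 = univ := by
    have hu : IsFaceVertexSet I (univ : Set V) := Or.inr ⟨∅, by simp⟩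
    have := (he (e.symm ⟨univ, hu⟩) ⟨Q, hQface⟩).1 (e.symm ⟨univ, hu⟩).2.subset
    rw [e.apply_symm_apply] at this
    exact univ_subset_iff.1 this
  have hsub : {F | IsFacetOf F Q} ⊆ range fun k => (Fk k).1 := by
    intro F hF
    have hFQ : F ≠ Q := by
      intro h
      have := hF.2
      rw [h] at this
      omega
    have hex : ∃ k, (e ⟨F, hF.1⟩).1 ⊆ {v | I k v} := by
      rcases (e ⟨F, hF.1⟩).2 with h | ⟨T, h⟩
      · exact ⟨Classical.arbitrary K, by rw [h]; exact empty_subset _⟩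
      · rcases T.eq_empty_or_nonempty with rfl | ⟨k, hk⟩
        · refine absurd (hF.1.subset.antisymm ((he ⟨Q, hQface⟩ ⟨F, hF.1⟩).2 ?_)) hFQ
          rw [h]
          simp
        · exact ⟨k, by rw [h]; exact fun v hv => hv k hk⟩
    obtain ⟨k, hk⟩ := hex
    refine ⟨k, (hF.eq_of_subset (Fk k).2 ?_ ?_).symm⟩
    · refine (he ⟨F, hF.1⟩ (Fk k)).2 ?_
      rw [hFk, e.apply_symm_apply]
      exact hk
    · intro h
      have h1 : Fk k = ⟨Q, hQface⟩ := Subtype.ext h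
      rw [← h1, hFk, e.apply_symm_apply] at htop
      obtain ⟨v, hv⟩ := hne k
      exact hv (htop.ge (mem_univ v))
  calc facetCount Q ≤ (range fun k => (Fk k).1).ncard := ncard_le_ncard hsub (finite_range _)
    _ ≤ Nat.card K := by
      rw [← Nat.card_coe_set_eq]
      exact Finite.card_range_le _

/-- Incidence between the five facets and the six vertices of `Δ_1 × Δ_2`: the facet `k` misses
exactly the vertices having `k` as a coordinate. -/
def prismIncidence (k : Fin 2 ⊕ Fin 3) (v : Fin 2 × Fin 3) : Prop :=
  k ≠ Sum.inl v.1 ∧ k ≠ Sum.inr v.2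

/-- The linear map concatenating two coordinate vectors. -/
def appendLinear (n m : ℕ) : (Fin n → ℝ) × (Fin m → ℝ) →ₗ[ℝ] (Fin (n + m) → ℝ) where
  toFun z := Fin.append z.1 z.2
  map_add' z w := by
    ext i
    refine Fin.addCases (fun i => ?_) (fun i => ?_) i <;> simp
  map_smul' c z := by
    ext i
    refine Fin.addCases (fun i => ?_) (fun i => ?_) i <;> simp

theorem simplexF_one : simplexF 1 = convexHull ℝ (range ![![(1 : ℝ)], ![-1]]) := by
  rw [simplexF]
  congr 1
  ext y
  simp [Set.mem_range, funext_iff, eq_comm]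

theorem simplexF_two :
    simplexF 2 = convexHull ℝ (range ![![(1 : ℝ), 0], ![0, 1], ![-1, -1]]) := by
  rw [simplexF]
  congr 1
  ext y
  simp [Set.mem_range, Fin.exists_fin_succ, funext_iff, Fin.forall_fin_two, Pi.single_apply,
    eq_comm]
  tauto

theorem mem_convexHull_range_of_weights {ι E : Type*} [Fintype ι] [AddCommGroup E] [Module ℝ E]
    {x : ι → E} {w : ι → ℝ} {y : E} (h0 : ∀ i, 0 ≤ w i) (h1 : ∑ i, w i = 1)
    (hy : ∑ i, w i • x i = y) : y ∈ convexHull ℝ (range x) :=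
  mem_convexHull_of_exists_fintype w x h0 h1 (fun i => mem_range_self i) hy

/-- The vertices of `prodP 1 2`. -/
def prismVertex (v : Fin 2 × Fin 3) : Fin (1 + 2) → ℝ :=
  Fin.append ((![![1], ![-1]] : Fin 2 → Fin 1 → ℝ) v.1)
    ((![![1, 0], ![0, 1], ![-1, -1]] : Fin 3 → Fin 2 → ℝ) v.2)

theorem prodP_eq_convexHull : prodP 1 2 = convexHull ℝ (range prismVertex) := by
  have h1 : prodP 1 2 = appendLinear 1 2 '' (simplexF 1 ×ˢ simplexF 2) := by
    ext z
    constructor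
    · rintro ⟨a, ha, b, hb, rfl⟩
      exact ⟨(a, b), ⟨ha, hb⟩, rfl⟩
    · rintro ⟨⟨a, b⟩, ⟨ha, hb⟩, rfl⟩
      exact ⟨a, ha, b, hb, rfl⟩
  rw [h1, simplexF_one, simplexF_two, ← convexHull_prod, LinearMap.image_convexHull,
    Set.prod_range_range_eq, ← range_comp]
  rfl

/-- The inequalities defining `prodP 1 2`. -/
def prismFunctional : Fin 2 ⊕ Fin 3 → (Fin (1 + 2) → ℝ) →ᵃ[ℝ] ℝ :=
  let Y : Fin (1 + 2) → (Fin (1 + 2) → ℝ) →ᵃ[ℝ] ℝ := fun i => (LinearMap.proj i).toAffineMap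
  let c : (Fin (1 + 2) → ℝ) →ᵃ[ℝ] ℝ := AffineMap.const ℝ _ 1
  Sum.elim ![c + Y 0, c - Y 0] ![c + (2 : ℝ) • Y 1 - Y 2, c - Y 1 + (2 : ℝ) • Y 2, c - Y 1 - Y 2]

theorem prismVertex_apply (s : Fin 2) (i : Fin 3) :
    prismVertex (s, i) 0 = ![1, -1] s ∧ prismVertex (s, i) 1 = ![1, 0, -1] i ∧
      prismVertex (s, i) 2 = ![0, 1, -1] i := by
  fin_cases s <;> fin_cases i <;> exact ⟨rfl, rfl, rfl⟩

theorem prismFunctional_prismVertex (k : Fin 2 ⊕ Fin 3) (v : Fin 2 × Fin 3) :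
    0 ≤ prismFunctional k (prismVertex v) ∧
      (prismFunctional k (prismVertex v) = 0 ↔ prismIncidence k v) := by
  obtain ⟨s, i⟩ := v
  have hz := prismVertex_apply s i
  generalize prismVertex (s, i) = z at hz ⊢
  obtain ⟨h0, h1, h2⟩ := hz
  rcases k with t | t <;> fin_cases t <;> fin_cases s <;> fin_cases i <;>
    norm_num [prismFunctional, prismIncidence, h0, h1, h2, Sum.inl_ne_inr, Sum.inr_ne_inl]

theorem mem_prodP_of_prismFunctional {y : Fin (1 + 2) → ℝ} (h : ∀ k, 0 ≤ prismFunctional k y) :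
    y ∈ prodP 1 2 := by
  have hA := h (Sum.inl 0)
  have hB := h (Sum.inl 1)
  have h0 := h (Sum.inr 0)
  have h1 := h (Sum.inr 1)
  have h2 := h (Sum.inr 2)
  simp [prismFunctional] at hA hB h0 h1 h2
  refine ⟨![y 0], ?_, ![y 1, y 2], ?_, ?_⟩
  · rw [simplexF_one]
    refine mem_convexHull_range_of_weights (w := ![(1 + y 0) / 2, (1 - y 0) / 2]) ?_ ?_ ?_
    · simp [Fin.forall_fin_two]
      constructor <;> linarith
    · simp
      ring
    · ext i
      fin_cases i
      simp
      ring
  · rw [simplexF_two]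
    refine mem_convexHull_range_of_weights (w := ![(1 + 2 * y 1 - y 2) / 3,
      (1 - y 1 + 2 * y 2) / 3, (1 - y 1 - y 2) / 3]) ?_ ?_ ?_
    · simp [Fin.forall_fin_succ]
      refine ⟨?_, ?_, ?_⟩ <;> linarith
    · simp [Fin.sum_univ_three]
      ring
    · ext i
      fin_cases i <;> simp [Fin.sum_univ_three] <;> ring
  · ext i
    fin_cases i <;> simp [Fin.append, Fin.addCases]

theorem exists_faceEquiv_prodP :
    ∃ e : {F : Set (Fin (1 + 2) → ℝ) // IsFaceOf F (prodP 1 2)} ≃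
        {A : Set (Fin 2 × Fin 3) // IsFaceVertexSet prismIncidence A},
      ∀ F₁ F₂, F₁.1 ⊆ F₂.1 ↔ (e F₁).1 ⊆ (e F₂).1 :=
  exists_faceEquiv prodP_eq_convexHull (fun k v => (prismFunctional_prismVertex k v).1)
    (fun k v => (prismFunctional_prismVertex k v).2)
    (fun _ _ => mem_prodP_of_prismFunctional)

theorem facetCount_le_five_of_combEquiv {M : ℕ} {Q : Set (Fin M → ℝ)}
    (h : CombEquiv Q (prodP 1 2)) : facetCount Q ≤ 5 := by
  obtain ⟨φ, hφ⟩ := h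
  obtain ⟨e, he⟩ := exists_faceEquiv_prodP
  have := facetCount_le_of_faceEquiv (I := prismIncidence) (fun k => by
    rcases k with s | i
    · exact ⟨(s, 0), fun h => h.1 rfl⟩
    · exact ⟨(0, i), fun h => h.2 rfl⟩) (φ.trans e) (fun F₁ F₂ => (hφ F₁ F₂).trans (he _ _))
  simpa using this

/-- The vertices of the projective prism with weights `ρ`: a vertex of `Δ_1 × Δ_2` is sent to the
sum of its two barycentric coordinate vectors, rescaled to `ρ`-weight one. -/
def weightedPrismVertex (ρ : Fin 2 ⊕ Fin 3 → ℝ) (v : Fin 2 × Fin 3) : Fin (2 + 3) → ℝ :=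
  (ρ (Sum.inl v.1) + ρ (Sum.inr v.2))⁻¹ •
    (Pi.single (finSumFinEquiv (Sum.inl v.1)) 1 + Pi.single (finSumFinEquiv (Sum.inr v.2)) 1)

theorem weightedPrismVertex_apply (ρ : Fin 2 ⊕ Fin 3 → ℝ) (v : Fin 2 × Fin 3) (k : Fin 2 ⊕ Fin 3) :
    weightedPrismVertex ρ v (finSumFinEquiv k) = (ρ (Sum.inl v.1) + ρ (Sum.inr v.2))⁻¹ *
      ((if k = Sum.inl v.1 then 1 else 0) + if k = Sum.inr v.2 then 1 else 0) := by
  simp only [weightedPrismVertex, Pi.smul_apply, Pi.add_apply, Pi.single_apply, smul_eq_mul,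
    EmbeddingLike.apply_eq_iff_eq]

theorem sum_mul_weightedPrismVertex (ρ g : Fin 2 ⊕ Fin 3 → ℝ) (v : Fin 2 × Fin 3) :
    ∑ k, g k * weightedPrismVertex ρ v (finSumFinEquiv k) =
      (ρ (Sum.inl v.1) + ρ (Sum.inr v.2))⁻¹ * (g (Sum.inl v.1) + g (Sum.inr v.2)) := by
  simp only [weightedPrismVertex_apply, mul_add, Finset.sum_add_distrib, mul_ite, mul_one, mul_zero,
    Finset.sum_ite_eq', Finset.mem_univ, if_true]
  ring

/-- The projective prism with weights `ρ`. -/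
def weightedPrism (ρ : Fin 2 ⊕ Fin 3 → ℝ) : Set (Fin (2 + 3) → ℝ) :=
  convexHull ℝ (range (weightedPrismVertex ρ))

section WeightedPrism

variable {ρ : Fin 2 ⊕ Fin 3 → ℝ}

theorem sum_mul_of_mem_affineSpan_weightedPrism (hρ : ∀ s i, 0 < ρ (Sum.inl s) + ρ (Sum.inr i))
    {g : Fin 2 ⊕ Fin 3 → ℝ} {c : ℝ}
    (hg : ∀ s i, g (Sum.inl s) + g (Sum.inr i) = c * (ρ (Sum.inl s) + ρ (Sum.inr i)))
    {y : Fin (2 + 3) → ℝ} (hy : y ∈ affineSpan ℝ (weightedPrism ρ)) :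
    ∑ k, g k * y (finSumFinEquiv k) = c := by
  rw [weightedPrism, affineSpan_convexHull] at hy
  set f : (Fin (2 + 3) → ℝ) →ᵃ[ℝ] ℝ := (∑ k, g k • (LinearMap.proj (finSumFinEquiv k) :
    (Fin (2 + 3) → ℝ) →ₗ[ℝ] ℝ)).toAffineMap - AffineMap.const ℝ _ c with hfdef
  have hf : ∀ z, f z = ∑ k, g k * z (finSumFinEquiv k) - c := by
    intro z
    simp only [hfdef, AffineMap.coe_sub, Pi.sub_apply, LinearMap.coe_toAffineMap,
      LinearMap.sum_apply, LinearMap.smul_apply, LinearMap.proj_apply, smul_eq_mul,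
      AffineMap.const_apply]
  have := eq_zero_of_mem_affineSpan (f := f) (by
    rintro _ ⟨⟨s, i⟩, rfl⟩
    rw [hf, sum_mul_weightedPrismVertex, hg]
    have := (hρ s i).ne'
    field_simp
    ring) hy
  rw [hf] at this
  linarith

theorem mem_weightedPrism (hρ : ∀ s i, 0 < ρ (Sum.inl s) + ρ (Sum.inr i))
    {y : Fin (2 + 3) → ℝ} (hy : y ∈ affineSpan ℝ (weightedPrism ρ))
    (h0 : ∀ k, 0 ≤ y (finSumFinEquiv k)) : y ∈ weightedPrism ρ := by
  have h1 := sum_mul_of_mem_affineSpan_weightedPrism hρ (g := ρ) (c := 1)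
    (fun s i => by rw [one_mul]) hy
  have h2 := sum_mul_of_mem_affineSpan_weightedPrism hρ (g := Sum.elim (fun _ => 1) fun _ => -1)
    (c := 0) (fun s i => by simp) hy
  set z : Fin 2 ⊕ Fin 3 → ℝ := fun k => y (finSumFinEquiv k) with hz
  change ∀ k, 0 ≤ z k at h0
  change ∑ k, ρ k * z k = 1 at h1
  change ∑ k, Sum.elim _ _ k * z k = 0 at h2
  simp only [Fintype.sum_sum_type, Sum.elim_inl, Sum.elim_inr, one_mul, neg_mul,
    Finset.sum_neg_distrib] at h1 h2
  set t := ∑ i, z (Sum.inr i) with ht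
  have ht' : ∑ s, z (Sum.inl s) = t := by linarith
  have ht0 : t ≠ 0 := by
    intro h
    have e1 := (Finset.sum_eq_zero_iff_of_nonneg (fun i _ => h0 (Sum.inr i))).1 (ht ▸ h)
    have e2 := (Finset.sum_eq_zero_iff_of_nonneg (fun s _ => h0 (Sum.inl s))).1 (ht'.trans h)
    rw [Finset.sum_eq_zero (fun s hs => by rw [e2 s hs, mul_zero]),
      Finset.sum_eq_zero (fun s hs => by rw [e1 s hs, mul_zero])] at h1
    norm_num at h1
  have htpos : 0 < t := lt_of_le_of_ne (Finset.sum_nonneg fun i _ => h0 _) ht0.symm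
  refine mem_convexHull_range_of_weights (w := fun v => (ρ (Sum.inl v.1) + ρ (Sum.inr v.2)) *
    (z (Sum.inl v.1) * z (Sum.inr v.2) / t)) ?_ ?_ ?_
  · exact fun v => mul_nonneg (hρ _ _).le (div_nonneg (mul_nonneg (h0 _) (h0 _)) htpos.le)
  · have : ∀ s i, (ρ (Sum.inl s) + ρ (Sum.inr i)) * (z (Sum.inl s) * z (Sum.inr i) / t) =
        t⁻¹ * (ρ (Sum.inl s) * z (Sum.inl s) * z (Sum.inr i)) +
          t⁻¹ * (z (Sum.inl s) * (ρ (Sum.inr i) * z (Sum.inr i))) := fun s i => by ring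
    simp only [Fintype.sum_prod_type, this, Finset.sum_add_distrib, ← Finset.mul_sum,
      ← Finset.sum_mul]
    rw [ht', ← ht, ← h1]
    field_simp
  · ext j
    obtain ⟨k, rfl⟩ := finSumFinEquiv.surjective j
    rw [Finset.sum_apply]
    have : ∀ v : Fin 2 × Fin 3, (((ρ (Sum.inl v.1) + ρ (Sum.inr v.2)) *
        (z (Sum.inl v.1) * z (Sum.inr v.2) / t)) • weightedPrismVertex ρ v) (finSumFinEquiv k) =
        t⁻¹ * (z (Sum.inl v.1) * z (Sum.inr v.2) *
          ((if k = Sum.inl v.1 then 1 else 0) + if k = Sum.inr v.2 then 1 else 0)) := by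
      intro v
      rw [Pi.smul_apply, weightedPrismVertex_apply, smul_eq_mul]
      have := (hρ v.1 v.2).ne'
      field_simp
    simp only [this, ← Finset.mul_sum, Fintype.sum_prod_type]
    change _ = z k
    rw [inv_mul_eq_iff_eq_mul₀ ht0]
    rcases k with s | i
    · simp only [Sum.inl.injEq, reduceCtorEq, if_false, add_zero, mul_ite, mul_one, mul_zero]
      rw [Finset.sum_comm]
      simp [← Finset.mul_sum, ← ht, mul_comm]
    · simp only [Sum.inr.injEq, reduceCtorEq, if_false, zero_add, mul_ite, mul_one, mul_zero]
      simp [← Finset.sum_mul, ht']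

theorem combEquiv_weightedPrism (hρ : ∀ s i, 0 < ρ (Sum.inl s) + ρ (Sum.inr i)) :
    CombEquiv (weightedPrism ρ) (prodP 1 2) := by
  have hval : ∀ k v, (LinearMap.proj (finSumFinEquiv k) :
      (Fin (2 + 3) → ℝ) →ₗ[ℝ] ℝ).toAffineMap (weightedPrismVertex ρ v) =
      (ρ (Sum.inl v.1) + ρ (Sum.inr v.2))⁻¹ *
        ((if k = Sum.inl v.1 then 1 else 0) + if k = Sum.inr v.2 then 1 else 0) :=
    fun k v => weightedPrismVertex_apply ρ v k
  obtain ⟨e₁, h₁⟩ := exists_faceEquiv (Q := weightedPrism ρ) (I := prismIncidence)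
    (l := fun k => (LinearMap.proj (finSumFinEquiv k) : (Fin (2 + 3) → ℝ) →ₗ[ℝ] ℝ).toAffineMap) rfl
    (fun k v => by
      rw [hval]
      refine mul_nonneg (inv_pos.2 (hρ _ _)).le (add_nonneg ?_ ?_) <;> split_ifs <;> norm_num)
    (fun k v => by
      rw [hval, mul_eq_zero, or_iff_right (inv_pos.2 (hρ _ _)).ne', prismIncidence]
      split_ifs <;> simp_all)
    (fun y hy h => mem_weightedPrism hρ hy h)
  obtain ⟨e₂, h₂⟩ := exists_faceEquiv_prodP
  exact ⟨e₁.trans e₂.symm, fun F₁ F₂ => by simp [h₁, h₂]⟩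

end WeightedPrism

theorem exists_weightedPrism_extension {N : ℕ} {a b : Fin 3 → (Fin N → ℝ)} {r s : Fin 3 → ℝ} {κ : ℝ}
    {w : Fin N → ℝ} (hr : ∀ i, 0 < r i) (hs : ∀ i, 0 < s i) (hκ : ∀ i, r i - s i = κ)
    (hw : ∀ i, r i • a i - s i • b i = w) :
    ∃ (e : ℕ) (Q : Set (Fin e → ℝ)) (π : (Fin e → ℝ) →ᵃ[ℝ] (Fin N → ℝ)),
      IsPolytope Q ∧ CombEquiv Q (prodP 1 2) ∧
        π '' Q = convexHull ℝ (range fun v : Fin 2 × Fin 3 => ![a, b] v.1 v.2) := by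
  set ρ : Fin 2 ⊕ Fin 3 → ℝ := Sum.elim ![κ, 0] s with hρ
  set z : Fin 2 ⊕ Fin 3 → (Fin N → ℝ) := Sum.elim ![w, 0] (fun i => s i • b i) with hz
  have hpos : ∀ s i, 0 < ρ (Sum.inl s) + ρ (Sum.inr i) := by
    intro t i
    fin_cases t
    · simpa [hρ, ← hκ i] using hr i
    · simpa [hρ] using hs i
  set π : (Fin (2 + 3) → ℝ) →ₗ[ℝ] (Fin N → ℝ) :=
    Fintype.linearCombination ℝ (fun j => z (finSumFinEquiv.symm j)) with hπ
  refine ⟨2 + 3, weightedPrism ρ, π.toAffineMap,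
    ⟨(finite_range (weightedPrismVertex ρ)).toFinset, by rw [Finite.coe_toFinset, weightedPrism]⟩,
    combEquiv_weightedPrism hpos, ?_⟩
  rw [weightedPrism, LinearMap.coe_toAffineMap, LinearMap.image_convexHull, ← range_comp]
  congr 2
  ext1 ⟨t, i⟩
  have hR := hpos t i
  simp only [Function.comp_apply, weightedPrismVertex, map_smul, map_add, hπ,
    Fintype.linearCombination_apply_single, one_smul, Equiv.symm_apply_apply]
  rw [inv_smul_eq_iff₀ hR.ne']
  fin_cases t
  · simp [hρ, hz, ← hκ i, ← hw i]
  · simp [hρ, hz]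

theorem CyclicLabeling.exists_prism_extension {N : ℕ} {P : Set (Fin N → ℝ)} (hP : IsPolytope P)
    {p : Fin 6 → (Fin N → ℝ)} (hp : CyclicLabeling P p)
    (hc : ConcurrentLines (affineSpan ℝ {p 0, p 1}) (affineSpan ℝ {p 5, p 2})
      (affineSpan ℝ {p 3, p 4})) :
    ∃ (e : ℕ) (Q : Set (Fin e → ℝ)) (π : (Fin e → ℝ) →ᵃ[ℝ] (Fin N → ℝ)),
      IsPolytope Q ∧ CombEquiv Q (prodP 1 2) ∧ π '' Q = P := by
  have hPc : P = convexHull ℝ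
      (range fun v : Fin 2 × Fin 3 => ![![p 1, p 2, p 3], ![p 0, p 5, p 4]] v.1 v.2) := by
    obtain ⟨S, hS, hSv⟩ := hP.exists_vertexSet
    have hsurj : Function.Surjective
        (fun v : Fin 2 × Fin 3 => (![![1, 2, 3], ![0, 5, 4]] v.1 v.2 : Fin 6)) := by decide
    rw [hS, ← hSv, ← hp.2.1, ← hsurj.range_comp p]
    congr 2
    ext1 ⟨t, i⟩
    fin_cases t <;> fin_cases i <;> rfl
  rw [hPc]
  rw [pair_comm (p 0), pair_comm (p 5)] at hc
  obtain ⟨g₀, -, g00, g01, hg0⟩ := hp.exists_functional 0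
  obtain ⟨g₁, -, g11, g12, hg1⟩ := hp.exists_functional 1
  obtain ⟨g₂, -, g22, g23, hg2⟩ := hp.exists_functional 2
  obtain ⟨g₃, -, g33, g34, hg3⟩ := hp.exists_functional 3
  change g₀ (p 1) = 0 at g01
  change g₁ (p 2) = 0 at g12
  change g₂ (p 3) = 0 at g23
  change g₃ (p 4) = 0 at g34
  have a02 := hg0 2 (by decide) (by decide)
  have a05 := hg0 5 (by decide) (by decide)
  have a03 := hg0 3 (by decide) (by decide)
  have a04 := hg0 4 (by decide) (by decide)
  have a10 := hg1 0 (by decide) (by decide)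
  have a15 := hg1 5 (by decide) (by decide)
  have a25 := hg2 5 (by decide) (by decide)
  have a24 := hg2 4 (by decide) (by decide)
  have a30 := hg3 0 (by decide) (by decide)
  have a31 := hg3 1 (by decide) (by decide)
  rcases hc with ⟨o, h0, h1, h2⟩ | ⟨h01, -, h02⟩
  · obtain ⟨t, ht⟩ := mem_affineSpan_pair_iff_exists_lineMap_eq.1 h0
    obtain ⟨u, hu⟩ := mem_affineSpan_pair_iff_exists_lineMap_eq.1 h1
    obtain ⟨s, hs⟩ := mem_affineSpan_pair_iff_exists_lineMap_eq.1 h2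
    rw [AffineMap.lineMap_apply_module] at ht hu hs
    have et : ∀ g : (Fin N → ℝ) →ᵃ[ℝ] ℝ, g o = (1 - t) * g (p 1) + t * g (p 0) := fun g => by
      rw [← ht, affineMap_convex_combo _ _ _ (by ring)]
    have eu : ∀ g : (Fin N → ℝ) →ᵃ[ℝ] ℝ, g o = (1 - u) * g (p 2) + u * g (p 5) := fun g => by
      rw [← hu, affineMap_convex_combo _ _ _ (by ring)]
    have es : ∀ g : (Fin N → ℝ) →ᵃ[ℝ] ℝ, g o = (1 - s) * g (p 3) + s * g (p 4) := fun g => by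
      rw [← hs, affineMap_convex_combo _ _ _ (by ring)]
    have outside : ∀ {x α β : ℝ}, 0 < α → 0 < β → (1 - x) * α + x * β = 0 → x < 0 ∨ 1 < x := by
      intro x α β hα hβ h
      by_contra! hx
      obtain ⟨h1, h2⟩ := hx
      rcases h1.eq_or_lt with rfl | h1
      · linarith
      · have := mul_pos h1 hβ
        have := mul_nonneg (sub_nonneg.2 h2) hα.le
        linarith
    have htt := outside (x := t) a31 a30 (by rw [← et, es, g33, g34]; ring)
    have huu := outside (x := u) a02 a05 (by rw [← eu, et, g00, g01]; ring)
    have hss := outside (x := s) a03 a04 (by rw [← es, et, g00, g01]; ring)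
    have htu : t * g₁ (p 0) = u * g₁ (p 5) := by
      have := (et g₁).symm.trans (eu g₁)
      rw [g11, g12] at this
      linarith
    have hus : u * g₂ (p 5) = s * g₂ (p 4) := by
      have := (eu g₂).symm.trans (es g₂)
      rw [g22, g23] at this
      linarith
    have sameSign : ∀ {x y α β : ℝ}, 0 < α → 0 < β → x * α = y * β → x < 0 → y < 0 := by
      intro x y α β hα hβ h hx
      by_contra! hy
      have := mul_neg_of_neg_of_pos hx hα
      have := mul_nonneg hy hβ.le
      linarith
    rcases huu with hun | hup
    · have htn := sameSign a15 a10 htu.symm hun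
      have hsn := sameSign a25 a24 hus hun
      refine exists_weightedPrism_extension (r := ![1 - t, 1 - u, 1 - s]) (s := ![-t, -u, -s]) (κ := 1)
        (w := o) ?_ ?_ ?_ ?_ <;> intro i <;> fin_cases i <;> simp <;> first | linarith | assumption
    · have htp : 1 < t := htt.resolve_left fun h =>
        (sameSign a10 a15 htu h).not_gt (by linarith)
      have hsp : 1 < s := hss.resolve_left fun h =>
        (sameSign a24 a25 hus.symm h).not_gt (by linarith)
      have hneg : ∀ (x : ℝ) (c d : Fin N → ℝ), (1 - x) • c + x • d = o →
          (x - 1) • c - x • d = -o := by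
        rintro x c d rfl
        rw [neg_add, ← neg_smul, neg_sub, sub_eq_add_neg]
      refine exists_weightedPrism_extension (r := ![t - 1, u - 1, s - 1]) (s := ![t, u, s]) (κ := -1)
        (w := -o) ?_ ?_ ?_ ?_ <;> intro i <;> fin_cases i <;> simp <;>
        first | linarith | (apply hneg; assumption)
  · rw [AffineSubspace.affineSpan_pair_parallel_iff_vectorSpan_eq] at h01 h02
    obtain ⟨c, hc⟩ := (mem_vectorSpan_pair (k := ℝ)).1
      (h01 ▸ vsub_mem_vectorSpan_pair (k := ℝ) (p 2) (p 5))
    obtain ⟨d, hd⟩ := (mem_vectorSpan_pair (k := ℝ)).1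
      (h02 ▸ vsub_mem_vectorSpan_pair (k := ℝ) (p 3) (p 4))
    simp only [vsub_eq_sub] at hc hd
    have ec : ∀ g : (Fin N → ℝ) →ᵃ[ℝ] ℝ, c * (g (p 1) - g (p 0)) = g (p 2) - g (p 5) := by
      intro g
      rw [← AffineMap.linear_sub_apply, ← AffineMap.linear_sub_apply, ← hc, map_smul, smul_eq_mul]
    have ed : ∀ g : (Fin N → ℝ) →ᵃ[ℝ] ℝ, d * (g (p 1) - g (p 0)) = g (p 3) - g (p 4) := by
      intro g
      rw [← AffineMap.linear_sub_apply, ← AffineMap.linear_sub_apply, ← hd, map_smul, smul_eq_mul]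
    have hcpos : 0 < c := by
      have := ec g₁
      rw [g11, g12] at this
      exact pos_of_mul_pos_left (b := g₁ (p 0)) (by linarith) a10.le
    have hdpos : 0 < d := by
      have h1 := ec g₂
      have h2 := ed g₂
      rw [g22] at h1
      rw [g23] at h2
      have : 0 < g₂ (p 0) - g₂ (p 1) := pos_of_mul_pos_right (a := c) (by linarith) hcpos.le
      exact pos_of_mul_pos_left (b := g₂ (p 0) - g₂ (p 1)) (by linarith) this.le
    refine exists_weightedPrism_extension (r := ![1, c⁻¹, d⁻¹]) (s := ![1, c⁻¹, d⁻¹]) (κ := 0)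
      (w := p 1 - p 0) ?_ ?_ ?_ ?_ <;> intro i <;> fin_cases i <;>
      simp [hcpos, hdpos, ← smul_sub, ← hc, ← hd, hcpos.ne', hdpos.ne']

theorem hexagon_tfae (N : ℕ) (P : Set (Fin N → ℝ))
    (hP : IsPolytope P) (hdP : pdim P = 2) (hv : vertexCount P = 6) :
    (xc P = 5 ↔
      ∃ (e : ℕ) (Q : Set (Fin e → ℝ)) (π : (Fin e → ℝ) →ᵃ[ℝ] (Fin N → ℝ)),
        IsPolytope Q ∧ CombEquiv Q (prodP 1 2) ∧ π '' Q = P) ∧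
    (xc P = 5 ↔ Desarguian P) := by
  have hhex : IsHexagon P := ⟨hP, hdP, hv⟩
  have h13 : xc P = 5 → Desarguian P := by
    intro h
    have hne := Nat.nonempty_of_pos_sInf (h ▸ Nat.succ_pos 4 : 0 < xc P)
    obtain ⟨e, Q, π, hQ, hπ, hf⟩ := Nat.sInf_mem hne
    exact (desarguian_of_extension hQ hπ hhex (hf.trans h).le).2
  have h32 : Desarguian P → ∃ (e : ℕ) (Q : Set (Fin e → ℝ))
      (π : (Fin e → ℝ) →ᵃ[ℝ] (Fin N → ℝ)),
      IsPolytope Q ∧ CombEquiv Q (prodP 1 2) ∧ π '' Q = P := by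
    rintro ⟨p, hp, hc⟩
    exact hp.exists_prism_extension hP hc
  have h21 : (∃ (e : ℕ) (Q : Set (Fin e → ℝ)) (π : (Fin e → ℝ) →ᵃ[ℝ] (Fin N → ℝ)),
      IsPolytope Q ∧ CombEquiv Q (prodP 1 2) ∧ π '' Q = P) → xc P = 5 := by
    rintro ⟨e, Q, π, hQ, hcomb, hπ⟩
    have h5 := (desarguian_of_extension hQ hπ hhex (facetCount_le_five_of_combEquiv hcomb)).1
    have hle : xc P ≤ 5 := Nat.sInf_le ⟨e, Q, π, hQ, hπ, h5⟩
    refine hle.antisymm (le_csInf ⟨5, e, Q, π, hQ, hπ, h5⟩ ?_)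
    rintro n ⟨e', Q', π', hQ', hπ', rfl⟩
    by_contra! hlt
    exact hlt.ne (desarguian_of_extension hQ' hπ' hhex hlt.le).1
  exact ⟨⟨h32 ∘ h13, h21⟩, h13, h21 ∘ h32⟩

end
end
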